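/- Let A be a σ-unital, stable C*-algebra (i.e. A ≅ A ⊗ K) and assume the multiplier algebra M(A) is nowhere scattered. Then for every positive element a ∈ A and every m ∈ ℕ there exist finitely many elements y₁, …, yₙ ∈ Cu(A) such that m·yⱼ ≤ [a] for every j ≤ n and [a] ≤ y₁ + … + yₙ. In particular, [a] is weakly (m,n)-divisible for some finite n. -/

import Mathlib

/-!
Common definitions: abstract Cuntz semigroups, divisibility, and C*-algebra notions
(nowhere scatteredness, σ-unitality, etc.) used to formalize the statements.
-/

open scoped MultiplierAlgebra ENNReal
open Filter Topology

noncomputable section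

universe uu vv

/-- The (sequential) way-below relation `x ≪ y` (compact containment) in a partially
ordered set: whenever an increasing sequence has a supremum lying above `y`, some term
of the sequence already lies above `x`. -/
def WayBelow {S : Type*} [PartialOrder S] (x y : S) : Prop :=
  ∀ f : ℕ → S, Monotone f → ∀ s : S, IsLUB (Set.range f) s → y ≤ s → ∃ n, x ≤ f n

/-- An abstract Cuntz semigroup (`Cu`-semigroup): a positively ordered abelian monoid in
which every increasing sequence has a supremum, every element is the supremum of a
`≪`-increasing sequence, addition preserves `≪`, and which satisfies the standard
axioms (O5) (almost algebraic order) and (O6) (almost Riesz decomposition), as well as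
the existence of infima with idempotents `∞y = sup_n n•y` (all of these hold in the
Cuntz semigroup of any C*-algebra). -/
class CuSemigroup (S : Type*) extends AddCommMonoid S, PartialOrder S where
  add_le_add' : ∀ a b : S, a ≤ b → ∀ c : S, c + a ≤ c + b
  zero_le' : ∀ x : S, 0 ≤ x
  exists_isLUB : ∀ f : ℕ → S, Monotone f → ∃ s : S, IsLUB (Set.range f) s
  exists_waybelow_seq : ∀ x : S, ∃ f : ℕ → S, Monotone f ∧
    (∀ n, WayBelow (f n) (f (n + 1))) ∧ IsLUB (Set.range f) x
  waybelow_add : ∀ {x y z w : S}, WayBelow x y → WayBelow z w → WayBelow (x + z) (y + w)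
  /-- axiom (O5) -/
  almost_algebraic : ∀ x' x y' y z : S, WayBelow x' x → WayBelow y' y → x + y ≤ z →
    ∃ c : S, y' ≤ c ∧ x' + c ≤ z ∧ z ≤ x + c
  /-- axiom (O6) -/
  almost_riesz : ∀ x' x y z : S, WayBelow x' x → x ≤ y + z →
    ∃ v w : S, v ≤ x ∧ v ≤ y ∧ w ≤ x ∧ w ≤ z ∧ x' ≤ v + w
  /-- `infty y = ∞·y = sup_n n•y` -/
  infty : S → S
  isLUB_infty : ∀ y : S, IsLUB (Set.range fun n : ℕ => n • y) (infty y)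
  /-- the infimum `x ⊓ ∞y`, which exists in the Cuntz semigroup of any C*-algebra -/
  meetInfty : S → S → S
  isGLB_meetInfty : ∀ x y : S, IsGLB {x, infty y} (meetInfty x y)

namespace CuDiv

variable {S : Type*} [CuSemigroup S]

/-- `x` is weakly `(m, n)`-divisible. -/
def IsWeaklyDivisible (m n : ℕ) (x : S) : Prop :=
  ∀ x' : S, WayBelow x' x → ∃ y : Fin n → S, x' ≤ ∑ j, y j ∧ ∀ j, m • y j ≤ x

/-- `x` is `(m, n)`-divisible. -/
def IsDivisible (m n : ℕ) (x : S) : Prop :=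
  ∀ x' : S, WayBelow x' x → ∃ y : S, x' ≤ n • y ∧ m • y ≤ x

/-- `x` is weakly `(m, ω)`-divisible. -/
def IsWeaklyOmegaDivisible (m : ℕ) (x : S) : Prop :=
  ∀ x' : S, WayBelow x' x → ∃ (n : ℕ) (y : Fin n → S), x' ≤ ∑ j, y j ∧ ∀ j, m • y j ≤ x

/-- `x` is `(m, ω)`-divisible. -/
def IsOmegaDivisible (m : ℕ) (x : S) : Prop :=
  ∀ x' : S, WayBelow x' x → ∃ (y : S) (n : ℕ), x' ≤ n • y ∧ m • y ≤ x

/-- `wdiv m x` is the least positive integer `n` such that `x` is weakly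
`(m,n)`-divisible, and `∞` if there is no such `n`. -/
def wdiv (m : ℕ) (x : S) : ℕ∞ :=
  sInf {N : ℕ∞ | ∃ n : ℕ, 1 ≤ n ∧ N = n ∧ IsWeaklyDivisible m n x}

/-- `Div m x` is the least positive integer `n` such that `x` is `(m,n)`-divisible,
and `∞` if there is no such `n`. -/
def Div (m : ℕ) (x : S) : ℕ∞ :=
  sInf {N : ℕ∞ | ∃ n : ℕ, 1 ≤ n ∧ N = n ∧ IsDivisible m n x}

/-- An element `x` is strongly soft if for every `x' ≪ x` there is `t` with
`x' + t ≤ x ≤ ∞t`. -/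
def StronglySoft (x : S) : Prop :=
  ∀ x' : S, WayBelow x' x → ∃ t : S, x' + t ≤ x ∧ x ≤ CuSemigroup.infty t

/-- The Cuntz semigroup characterization of the Global Glimm Property: every element is
`(m, ω)`-divisible for every `m`. -/
def GlobalGlimm (S : Type*) [CuSemigroup S] : Prop :=
  ∀ (m : ℕ) (x : S), IsOmegaDivisible m x

/-- `Cu(A)` is left-soft separative. -/
def LeftSoftSeparative (S : Type*) [CuSemigroup S] : Prop :=
  ∀ x y t : S, StronglySoft x → WayBelow (x + t) (y + t) →
    WayBelow t (CuSemigroup.infty y) → WayBelow t (CuSemigroup.infty x) → WayBelow x y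

/-- `Cu(A)` is weakly cancellative. -/
def WeaklyCancellative (S : Type*) [CuSemigroup S] : Prop :=
  ∀ x y z : S, WayBelow (x + z) (y + z) → WayBelow x y

/-- `Cu(A)` has covering dimension zero. -/
def CoveringDimZero (S : Type*) [CuSemigroup S] : Prop :=
  ∀ x' x y₁ y₂ : S, WayBelow x' x → WayBelow x (y₁ + y₂) →
    ∃ z₁ z₂ : S, z₁ ≤ y₁ ∧ z₂ ≤ y₂ ∧ x' ≤ z₁ + z₂ ∧ z₁ + z₂ ≤ x

end CuDiv

/-- A functional on a Cuntz semigroup: an additive, order preserving map to `ℝ≥0∞`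
preserving suprema of increasing sequences.  (By Elliott–Robert–Santiago, the
functionals on `Cu(A)` are exactly those induced by the lower semicontinuous
2-quasitraces on `A ⊗ K`.) -/
structure CuFunctional (S : Type*) [CuSemigroup S] where
  toFun : S → ℝ≥0∞
  map_zero' : toFun 0 = 0
  map_add' : ∀ x y : S, toFun (x + y) = toFun x + toFun y
  mono' : ∀ x y : S, x ≤ y → toFun x ≤ toFun y
  sup' : ∀ f : ℕ → S, Monotone f → ∀ s : S, IsLUB (Set.range f) s →
    toFun s = ⨆ n, toFun (f n)

instance {S : Type*} [CuSemigroup S] : CoeFun (CuFunctional S) fun _ => S → ℝ≥0∞ :=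
  ⟨CuFunctional.toFun⟩

namespace CuDiv

variable {S : Type*} [CuSemigroup S]

/-- `x <ₛ y` : there is `γ < 1` with `λ(x) ≤ γ·λ(y)` for every functional `λ`. -/
def FunctionalLT (x y : S) : Prop :=
  ∃ γ : ℝ≥0∞, γ < 1 ∧ ∀ lam : CuFunctional S, lam x ≤ γ * lam y

/-- `A` has `k`-comparison (stated on `Cu(A)`). -/
def KComparison (S : Type*) [CuSemigroup S] (k : ℕ) : Prop :=
  ∀ (x : S) (b : Fin (k + 1) → S), (∀ i, FunctionalLT x (b i)) → x ≤ ∑ i, b i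

/-- `A` has strict comparison (stated on `Cu(A)`, via functionals, which correspond to
the lower semicontinuous 2-quasitraces). -/
def StrictComparison (S : Type*) [CuSemigroup S] : Prop :=
  ∀ x y : S, FunctionalLT x y → x ≤ y

/-- The natural topology on the cone `F(Cu(A))` of functionals. -/
def functionalTopology (S : Type*) [CuSemigroup S] : TopologicalSpace (CuFunctional S) :=
  TopologicalSpace.generateFrom
    ({U | ∃ (x : S) (r : ℝ≥0∞), U = {lam : CuFunctional S | r < lam x}} ∪
      {U | ∃ (x' x : S) (r : ℝ≥0∞), WayBelow x' x ∧ U = {lam : CuFunctional S | lam x' < r}})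

/-- A lower semicontinuous affine function on the cone of functionals of `Cu(A)`,
i.e. an element of `L(F(Cu(A)))`. -/
def IsLscAffine (F : CuFunctional S → ℝ≥0∞) : Prop :=
  (letI := functionalTopology S; LowerSemicontinuous F) ∧
    (∀ lam mu nu : CuFunctional S, (∀ x, nu x = lam x + mu x) → F nu = F lam + F mu) ∧
    (∀ (r : ℝ≥0∞) (lam nu : CuFunctional S), (∀ x, nu x = r * lam x) → F nu = r * F lam)

/-- The rank map of `Cu(A)` is surjective: every lower semicontinuous affine function on
the cone of functionals is realized as the rank function `λ ↦ λ(x)` of an element. -/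
def SurjectiveRankMap (S : Type*) [CuSemigroup S] : Prop :=
  ∀ F : CuFunctional S → ℝ≥0∞, IsLscAffine F → ∃ y : S, ∀ lam : CuFunctional S, lam y = F lam

end CuDiv

/-! ### C*-algebra notions -/

section CStar

variable {B : Type*} [NonUnitalCStarAlgebra B]

/-- Positivity in a C*-algebra: `a` is positive iff it is of the form `star b * b`. -/
def CStarNonneg (a : B) : Prop := ∃ b : B, a = star b * b

/-- Cuntz subequivalence `a ≼ b` : `a = lim_n rₙ b rₙ*`. -/
def CuntzBelow (a b : B) : Prop :=
  ∃ r : ℕ → B, Tendsto (fun n => r n * b * star (r n)) atTop (𝓝 a)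

/-- Cuntz equivalence. -/
def CuntzEquiv (a b : B) : Prop := CuntzBelow a b ∧ CuntzBelow b a

/-- `A` is σ-unital: it has a countable (norm-bounded, positive) approximate unit. -/
def SigmaUnital (A : Type*) [NonUnitalCStarAlgebra A] : Prop :=
  ∃ e : ℕ → A, (∀ n, CStarNonneg (e n) ∧ ‖e n‖ ≤ 1) ∧
    ∀ a : A, Tendsto (fun n => e n * a) atTop (𝓝 a) ∧ Tendsto (fun n => a * e n) atTop (𝓝 a)

end CStar

/-- A closed two-sided (automatically star-closed) ideal of a C*-algebra. -/
structure ClosedTwoSidedIdealC (A : Type*) [NonUnitalCStarAlgebra A] where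
  carrier : NonUnitalStarSubalgebra ℂ A
  isClosed : IsClosed (carrier : Set A)
  mul_mem_left : ∀ a : A, ∀ x ∈ carrier, a * x ∈ carrier
  mul_mem_right : ∀ a : A, ∀ x ∈ carrier, x * a ∈ carrier

section Reps

variable {A : Type*} [NonUnitalCStarAlgebra A]
variable {H : Type*} [NormedAddCommGroup H] [InnerProductSpace ℂ H] [CompleteSpace H]

/-- A (topologically) irreducible representation of `A` on a Hilbert space `H`. -/
def IsIrreducibleRep (π : A →⋆ₙₐ[ℂ] (H →L[ℂ] H)) : Prop :=
  (∃ a : A, π a ≠ 0) ∧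
    ∀ K : Submodule ℂ H, IsClosed (K : Set H) → (∀ a : A, ∀ v ∈ K, π a v ∈ K) →
      K = ⊥ ∨ K = ⊤

end Reps

/-- `A` has a nonzero elementary ideal-quotient `J/I`, expressed via a surjection of a
closed two-sided ideal `J` of `A` onto the algebra of compact operators on a Hilbert
space (the kernel `I` of such a `*`-homomorphism is automatically a closed two-sided
ideal of `A`, and conversely any nonzero elementary ideal-quotient arises this way). -/
def HasNonzeroElementaryIdealQuotient (A : Type*) [NonUnitalCStarAlgebra A] : Prop :=
  ∃ (J : ClosedTwoSidedIdealC A) (H : Type) (_ : NormedAddCommGroup H)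
    (_ : InnerProductSpace ℂ H) (_ : CompleteSpace H)
    (ψ : J.carrier →⋆ₙₐ[ℂ] (H →L[ℂ] H)),
      Set.range ψ = {T : H →L[ℂ] H | IsCompactOperator ⇑T} ∧ ∃ x, ψ x ≠ 0

/-- A C*-algebra is nowhere scattered if no ideal-quotient of it is nonzero and
elementary. -/
def NowhereScattered (A : Type*) [NonUnitalCStarAlgebra A] : Prop :=
  ¬ HasNonzeroElementaryIdealQuotient A

/-- A C*-algebra is elementary if it is isomorphic to the algebra of compact operators
on some Hilbert space. -/
def IsElementaryCStar (A : Type*) [NonUnitalCStarAlgebra A] : Prop :=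
  ∃ (H : Type) (_ : NormedAddCommGroup H) (_ : InnerProductSpace ℂ H) (_ : CompleteSpace H)
    (ψ : A →⋆ₙₐ[ℂ] (H →L[ℂ] H)),
      Function.Injective ψ ∧ Set.range ψ = {T : H →L[ℂ] H | IsCompactOperator ⇑T}

/-- A C*-algebra is simple if it is nonzero and has no nontrivial closed two-sided
ideals. -/
def IsSimpleCStar (A : Type*) [NonUnitalCStarAlgebra A] : Prop :=
  (∃ a : A, a ≠ 0) ∧
    ∀ J : ClosedTwoSidedIdealC A, (J.carrier : Set A) = {0} ∨ (J.carrier : Set A) = Set.univ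

/-- Real rank zero: the invertible self-adjoint elements are dense in the self-adjoint
part of the minimal unitization. -/
def RealRankZero (A : Type*) [NonUnitalCStarAlgebra A] : Prop :=
  ∀ x : Unitization ℂ A, IsSelfAdjoint x →
    x ∈ closure {y : Unitization ℂ A | IsSelfAdjoint y ∧ IsUnit y}

/-- Stable rank one: the invertible elements are dense in the minimal unitization. -/
def StableRankOne (A : Type*) [NonUnitalCStarAlgebra A] : Prop :=
  ∀ x : Unitization ℂ A, x ∈ closure {y : Unitization ℂ A | IsUnit y}

section CP

variable {A B : Type*} [NonUnitalCStarAlgebra A] [NonUnitalCStarAlgebra B]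

/-- A linear map between C*-algebras is completely positive if all of its matrix
amplifications preserve positivity. -/
def IsCompletelyPositive (φ : A →ₗ[ℂ] B) : Prop :=
  ∀ (n : ℕ) (a : Matrix (Fin n) (Fin n) A), (∃ b : Matrix (Fin n) (Fin n) A, a = star b * b) →
    ∃ c : Matrix (Fin n) (Fin n) B, a.map ⇑φ = star c * c

/-- A completely positive contractive (c.p.c.) map. -/
def IsCPC (φ : A →ₗ[ℂ] B) : Prop :=
  IsCompletelyPositive φ ∧ ∀ a : A, ‖φ a‖ ≤ ‖a‖

/-- A map between C*-algebras has order zero if it preserves orthogonality of positive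
elements. -/
def IsOrderZero (φ : A →ₗ[ℂ] B) : Prop :=
  ∀ a b : A, CStarNonneg a → CStarNonneg b → a * b = 0 → φ a * φ b = 0

end CP

/-- `A` has nuclear dimension at most `k`: there are c.p.c. approximations of the
identity through finite dimensional C*-algebras in which the downwards maps are sums of
`k+1` c.p.c. order zero maps. -/
def NuclearDimLE (A : Type*) [NonUnitalCStarAlgebra A] (k : ℕ) : Prop :=
  ∀ (F : Finset A) (ε : ℝ), 0 < ε →
    ∃ (Fd : Type) (_ : NonUnitalCStarAlgebra Fd) (_ : FiniteDimensional ℂ Fd)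
      (ψ : A →ₗ[ℂ] Fd) (φ : Fin (k + 1) → (Fd →ₗ[ℂ] A)),
        IsCPC ψ ∧ (∀ i, IsCPC (φ i) ∧ IsOrderZero (φ i)) ∧
        ∀ a ∈ F, ‖(∑ i, φ i (ψ a)) - a‖ ≤ ε

section Prim

variable (A : Type*) [NonUnitalCStarAlgebra A]

/-- A primitive ideal: the kernel of an irreducible representation. -/
def IsPrimitiveIdeal {A : Type*} [NonUnitalCStarAlgebra A] (J : ClosedTwoSidedIdealC A) : Prop :=
  ∃ (H : Type) (_ : NormedAddCommGroup H) (_ : InnerProductSpace ℂ H) (_ : CompleteSpace H)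
    (π : A →⋆ₙₐ[ℂ] (H →L[ℂ] H)),
      IsIrreducibleRep π ∧ ∀ a : A, a ∈ J.carrier ↔ π a = 0

/-- The primitive ideal space of `A`. -/
def PrimIdealSpace := {J : ClosedTwoSidedIdealC A // IsPrimitiveIdeal J}

/-- The hull-kernel (Jacobson) topology on the primitive ideal space. -/
instance : TopologicalSpace (PrimIdealSpace A) :=
  TopologicalSpace.generateFrom {U | ∃ a : A, U = {P : PrimIdealSpace A | a ∉ P.1.carrier}}

/-- `A` has topological dimension zero: the primitive ideal space has a basis of
compact open sets. -/
def TopDimZero : Prop :=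
  ∃ 𝒷 : Set (Set (PrimIdealSpace A)), TopologicalSpace.IsTopologicalBasis 𝒷 ∧
    ∀ U ∈ 𝒷, IsCompact U ∧ IsOpen U

end Prim

section Proj

variable {B : Type*} [NonUnitalCStarAlgebra B]

/-- A projection in a C*-algebra. -/
def IsProjectionElem (p : B) : Prop := IsSelfAdjoint p ∧ p * p = p

/-- `B` contains an infinite projection: a projection which is Murray-von Neumann
equivalent to a proper subprojection of itself. -/
def HasInfiniteProjection (B : Type*) [NonUnitalCStarAlgebra B] : Prop :=
  ∃ p v : B, IsProjectionElem p ∧ star v * v = p ∧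
    p * (v * star v) = v * star v ∧ v * star v ≠ p

end Proj

/-! ### The Cuntz semigroup of a C*-algebra -/

/-- Padding a matrix by one extra row and column of zeros. -/
def matPad {A : Type*} [Zero A] {n : ℕ} (a : Matrix (Fin n) (Fin n) A) :
    Matrix (Fin (n + 1)) (Fin (n + 1)) A :=
  Matrix.of fun i j =>
    if h : (i : ℕ) < n ∧ (j : ℕ) < n then a ⟨i, h.1⟩ ⟨j, h.2⟩ else 0

/-- A witness that `S` is the Cuntz semigroup of the C*-algebra `A`: it provides a
stabilization `stab` of `A` (a model of `A ⊗ K`, described as the C*-completion of the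
union of the matrix algebras `Mₙ(A)`), together with the class map
`cls : (stab)₊ → S = Cu(A)` identifying `S` with the set of Cuntz equivalence classes of
positive elements of `A ⊗ K`, with order induced by Cuntz subequivalence, addition
induced by orthogonal (diagonal) addition, and with the compact containment relation
`≪` given by `x ≪ [a]` iff `x ≤ [(a - ε)₊]` for some `ε > 0`. -/
structure IsCuntzSemigroupOf (A : Type uu) [NonUnitalCStarAlgebra A]
    (S : Type vv) [CuSemigroup S] where
  stab : Type (max uu vv)
  [stabCStar : NonUnitalCStarAlgebra stab]
  matEmb : (n : ℕ) → (Matrix (Fin n) (Fin n) A →⋆ₙₐ[ℂ] stab)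
  matEmb_injective : ∀ n, Function.Injective (matEmb n)
  matEmb_compat : ∀ (n : ℕ) (a : Matrix (Fin n) (Fin n) A), matEmb (n + 1) (matPad a) = matEmb n a
  matEmb_dense : Dense (⋃ n, Set.range (matEmb n))
  cls : stab → S
  cls_zero : cls 0 = 0
  cls_surj : ∀ s : S, ∃ b : stab, CStarNonneg b ∧ cls b = s
  cls_le_iff : ∀ a b : stab, CStarNonneg a → CStarNonneg b → (cls a ≤ cls b ↔ CuntzBelow a b)
  cls_add_orth : ∀ a b : stab, CStarNonneg a → CStarNonneg b → a * b = 0 →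
    cls (a + b) = cls a + cls b
  exists_orth : ∀ a b : stab, CStarNonneg a → CStarNonneg b →
    ∃ a' b' : stab, CStarNonneg a' ∧ CStarNonneg b' ∧ a' * b' = 0 ∧
      cls a' = cls a ∧ cls b' = cls b
  waybelow_iff : ∀ (x : S) (a : stab), CStarNonneg a →
    (WayBelow x (cls a) ↔ ∃ ε : ℝ, 0 < ε ∧ x ≤ cls (cfcₙ (fun t : ℝ => max (t - ε) 0) a))

attribute [instance] IsCuntzSemigroupOf.stabCStar

/-- The Cuntz class `[a] ∈ Cu(A)` of an element `a` of `A` itself (via the canonical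
embedding `A ≅ M₁(A) ⊆ A ⊗ K`). -/
def IsCuntzSemigroupOf.clsA {A : Type*} [NonUnitalCStarAlgebra A] {S : Type*} [CuSemigroup S]
    (h : IsCuntzSemigroupOf A S) (a : A) : S :=
  h.cls (h.matEmb 1 (Matrix.of fun _ _ => a))

/-- `B` has a surjective rank map (every lower semicontinuous affine function on the
cone of functionals on `Cu(B)` is realized as a rank function). -/
def HasSurjectiveRankMap (B : Type*) [NonUnitalCStarAlgebra B] : Prop :=
  ∀ (S : Type) (inst : CuSemigroup S), IsCuntzSemigroupOf B S → CuDiv.SurjectiveRankMap S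

/-- The family of separable sub-C*-algebras of `A` having a surjective rank map. -/
def sepSurjRankFamily (A : Type*) [NonUnitalCStarAlgebra A] :
    Set (NonUnitalStarSubalgebra ℂ A) :=
  {B | ∃ _h : IsClosed (B : Set A),
    TopologicalSpace.SeparableSpace B ∧ HasSurjectiveRankMap B}

/-- The family of separable sub-C*-algebras of `A` with a surjective rank map is
σ-complete (closed under countable increasing unions) and cofinal (every separable
sub-C*-algebra is contained in a member). -/
def SepSurjRankFamilySigmaCompleteCofinal (A : Type*) [NonUnitalCStarAlgebra A] : Prop :=
  (∀ Bseq : ℕ → NonUnitalStarSubalgebra ℂ A, Monotone Bseq →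
    (∀ n, Bseq n ∈ sepSurjRankFamily A) →
      (⨆ n, Bseq n).topologicalClosure ∈ sepSurjRankFamily A) ∧
  (∀ C : NonUnitalStarSubalgebra ℂ A, IsClosed (C : Set A) →
    TopologicalSpace.SeparableSpace C → ∃ B ∈ sepSurjRankFamily A, C ≤ B)

end

section ElementaryQuotient

variable {H : Type*} [NormedAddCommGroup H] [InnerProductSpace ℂ H] [CompleteSpace H]

/-- The closed linear span of the rank-one operators. -/
noncomputable def rankOneClosure (H : Type*) [NormedAddCommGroup H] [InnerProductSpace ℂ H]
    [CompleteSpace H] : Submodule ℂ (H →L[ℂ] H) :=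
  (Submodule.span ℂ {T | ∃ x y : H, T = InnerProductSpace.rankOne ℂ x y}).topologicalClosure

theorem rankOne_mem_rankOneClosure (x y : H) :
    InnerProductSpace.rankOne ℂ x y ∈ rankOneClosure H :=
  Submodule.le_topologicalClosure _ (Submodule.subset_span ⟨x, y, rfl⟩)

theorem isClosed_rankOneClosure : IsClosed (rankOneClosure H : Set (H →L[ℂ] H)) :=
  Submodule.isClosed_topologicalClosure _

/-- To show that the closed span of the rank-one operators lies in a closed subspace, it suffices to
check rank-one operators. -/
theorem rankOneClosure_le {K : Submodule ℂ (H →L[ℂ] H)} (hK : IsClosed (K : Set (H →L[ℂ] H)))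
    (h : ∀ x y : H, InnerProductSpace.rankOne ℂ x y ∈ K) : rankOneClosure H ≤ K := by
  refine Submodule.topologicalClosure_minimal _ (Submodule.span_le.2 ?_) hK
  rintro _ ⟨x, y, rfl⟩
  exact h x y

theorem mul_mem_rankOneClosure (S : H →L[ℂ] H) {T : H →L[ℂ] H} (hT : T ∈ rankOneClosure H) :
    S * T ∈ rankOneClosure H := by
  have : rankOneClosure H ≤ (rankOneClosure H).comap
      (ContinuousLinearMap.mul ℂ (H →L[ℂ] H) S).toLinearMap := by
    refine rankOneClosure_le (isClosed_rankOneClosure.preimage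
      (ContinuousLinearMap.mul ℂ (H →L[ℂ] H) S).continuous) fun x y => ?_
    have : S * InnerProductSpace.rankOne ℂ x y = InnerProductSpace.rankOne ℂ (S x) y :=
      InnerProductSpace.comp_rankOne x y S
    simpa [this] using rankOne_mem_rankOneClosure (S x) y
  exact this hT

theorem star_mem_rankOneClosure {T : H →L[ℂ] H} (hT : T ∈ rankOneClosure H) :
    star T ∈ rankOneClosure H := by
  have : T ∈ closure (Submodule.span ℂ {T | ∃ x y : H, T = InnerProductSpace.rankOne ℂ x y} :
      Set (H →L[ℂ] H)) := hT
  refine map_mem_closure continuous_star this fun S hS => ?_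
  induction hS using Submodule.span_induction with
  | mem S hS =>
    obtain ⟨x, y, rfl⟩ := hS
    refine Submodule.subset_span ⟨y, x, ?_⟩
    rw [ContinuousLinearMap.star_eq_adjoint]
    exact InnerProductSpace.adjoint_rankOne x y
  | zero => simp
  | add S T _ _ hS hT => simpa using add_mem hS hT
  | smul c S _ hS => simpa [star_smul] using Submodule.smul_mem _ _ hS

theorem mem_rankOneClosure_mul (S : H →L[ℂ] H) {T : H →L[ℂ] H} (hT : T ∈ rankOneClosure H) :
    T * S ∈ rankOneClosure H := by
  simpa using star_mem_rankOneClosure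
    (mul_mem_rankOneClosure (star S) (star_mem_rankOneClosure hT))

theorem isCompactOperator_of_mem_rankOneClosure {T : H →L[ℂ] H} (hT : T ∈ rankOneClosure H) :
    IsCompactOperator T := by
  have h : rankOneClosure H ≤ compactOperator (RingHom.id ℂ) H H := by
    refine rankOneClosure_le isClosed_setOfPred_isCompactOperator fun x y => ?_
    change IsCompactOperator
      ((ContinuousLinearMap.toSpanSingleton ℂ x) ∘ (innerSL ℂ y : H →L[ℂ] ℂ))
    exact (isCompactOperator_of_locallyCompactSpace_dom
      (innerSL ℂ y : H →L[ℂ] ℂ)).clm_comp _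
  exact h hT

/-- On a Hilbert space, compact operators are norm limits of finite-rank operators. -/
theorem mem_rankOneClosure_of_isCompactOperator {T : H →L[ℂ] H} (hT : IsCompactOperator T) :
    T ∈ rankOneClosure H := by
  refine isClosed_rankOneClosure.closure_subset (Metric.mem_closure_iff.2 fun ε hε => ?_)
  obtain ⟨K, hK, hTK⟩ := hT.image_closedBall_subset_compact (f := T.toLinearMap) 1
  obtain ⟨t, -, ht, hcov⟩ := hK.finite_cover_balls (half_pos hε)
  let U : Submodule ℂ H := Submodule.span ℂ t
  have : FiniteDimensional ℂ U := FiniteDimensional.span_of_finite ℂ ht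
  have hP : U.starProjection ∈ rankOneClosure H := by
    rw [(stdOrthonormalBasis ℂ U).starProjection_eq_sum_rankOne]
    exact sum_mem fun i _ => rankOne_mem_rankOneClosure _ _
  refine ⟨U.starProjection * T, mem_rankOneClosure_mul T hP, ?_⟩
  rw [dist_eq_norm]
  refine lt_of_le_of_lt (ContinuousLinearMap.opNorm_le_of_unit_norm (half_pos hε).le
    fun v hv => ?_) (half_lt_self hε)
  have hTv : T v ∈ K := hTK ⟨v, by simp [hv], rfl⟩
  obtain ⟨y, hyt, hy⟩ := Set.mem_iUnion₂.1 (hcov hTv)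
  have hyU : y ∈ U := Submodule.subset_span hyt
  calc ‖(T - U.starProjection * T) v‖ = ‖T v - U.starProjection (T v)‖ := rfl
    _ ≤ ‖T v - y‖ := by
      rw [U.starProjection_minimal]
      exact ciInf_le ⟨0, by rintro _ ⟨z, rfl⟩; positivity⟩ (⟨y, hyU⟩ : U)
    _ ≤ ε / 2 := by rw [← dist_eq_norm]; exact (Metric.mem_ball.1 hy).le

theorem continuous_rankOne (H : Type*) [NormedAddCommGroup H] [InnerProductSpace ℂ H] :
    Continuous fun q : H × H => InnerProductSpace.rankOne ℂ q.1 q.2 := by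
  have h1 : Continuous fun q : H × H => (ContinuousLinearMap.toSpanSingleton ℂ q.1 : ℂ →L[ℂ] H) :=
    (ContinuousLinearMap.toSpanSingletonCLE (𝕜 := ℂ) (E := H)).continuous.comp continuous_fst
  have h2 : Continuous fun q : H × H => (innerSL ℂ q.2 : H →L[ℂ] ℂ) :=
    (innerSL ℂ).continuous.comp continuous_snd
  exact h1.clm_comp h2

end ElementaryQuotient

section ClosedRange

open scoped CStarAlgebra

variable {M N : Type*} [CStarAlgebra M] [CStarAlgebra N]

/-- Elements in the range of a unital `⋆`-homomorphism of C*-algebras lift without increasing the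
norm. -/
theorem StarAlgHom.exists_lift_norm_le (ρ : M →⋆ₐ[ℂ] N) (y : M) :
    ∃ y' : M, ρ y' = ρ y ∧ ‖y'‖ ≤ ‖ρ y‖ := by
  rcases (norm_nonneg (ρ y)).eq_or_lt with h0 | hR
  · exact ⟨0, by rw [map_zero]; exact (norm_eq_zero.1 h0.symm).symm, by simp⟩
  set R := ‖ρ y‖ with hRdef
  obtain ⟨h, hdef⟩ : ∃ h : ℝ → ℝ, ∀ t, h t = R / max R (√t) := ⟨_, fun _ => rfl⟩
  have hh : Continuous h := by
    rw [funext hdef]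
    refine continuous_const.div (by fun_prop) fun t => ?_
    exact (lt_of_lt_of_le hR (le_max_left _ _)).ne'
  obtain ⟨a, ha⟩ : ∃ a, a = star y * y := ⟨_, rfl⟩
  have hsa : IsSelfAdjoint a := ha ▸ IsSelfAdjoint.star_mul_self y
  have hspec : ∀ t ∈ spectrum ℝ a, 0 ≤ t := by
    rw [ha]
    exact spectrum_star_mul_self_nonneg
  have hc := hh.continuousOn (s := spectrum ℝ a)
  refine ⟨y * cfc h a, ?_, ?_⟩
  · have hρ : Continuous ρ := map_continuous ρ
    have hmap : ρ (cfc h a) = cfc h (ρ a) :=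
      StarAlgHom.map_cfc (R := ℝ) (S := ℂ) (p := IsSelfAdjoint) (q := IsSelfAdjoint) ρ h a
        hc hρ hsa (hsa.map ρ)
    have : Nontrivial N := ⟨ρ y, 0, norm_pos_iff.1 hR⟩
    have h1 : cfc h (ρ a) = 1 := by
      rw [← cfc_const_one ℝ (ρ a) (hsa.map ρ)]
      refine cfc_congr fun t ht => ?_
      have ht2 : t ≤ R ^ 2 := by
        have := spectrum.norm_le_norm_of_mem ht
        rw [ha, map_mul, map_star, CStarRing.norm_star_mul_self, ← sq] at this
        exact (le_abs_self t).trans this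
      have : √t ≤ R := Real.sqrt_le_iff.2 ⟨hR.le, ht2⟩
      rw [hdef, max_eq_left this, div_self hR.ne']
    rw [map_mul, hmap, h1, mul_one]
  · have hsc : star (cfc h a) = cfc h a := (cfc_predicate (R := ℝ) (p := IsSelfAdjoint) h a)
    have : ‖y * cfc h a‖ * ‖y * cfc h a‖ ≤ R ^ 2 := by
      rw [← CStarRing.norm_star_mul_self, star_mul, hsc]
      have : cfc h a * star y * (y * cfc h a) = cfc (fun t => h t * t * h t) a := by
        rw [cfc_mul (fun t => h t * t) h a (hc.mul continuousOn_id) hc,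
          cfc_mul h (fun t => t) a hc continuousOn_id, cfc_id' ℝ a hsa, ha]
        simp only [mul_assoc]
      rw [this]
      refine norm_cfc_le (by positivity) fun t ht => ?_
      have ht0 : 0 ≤ t := hspec t ht
      have hmax : 0 < max R (√t) := lt_of_lt_of_le hR (le_max_left _ _)
      have : h t * t * h t = R ^ 2 * (√t / max R (√t)) ^ 2 := by
        rw [hdef, div_pow, Real.sq_sqrt ht0]
        ring
      rw [this, Real.norm_of_nonneg (by positivity)]
      have : √t / max R (√t) ≤ 1 := (div_le_one hmax).2 (le_max_right _ _)
      have h2 : (√t / max R (√t)) ^ 2 ≤ 1 := pow_le_one₀ (by positivity) this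
      exact mul_le_of_le_one_right (sq_nonneg R) h2
    exact abs_le_of_sq_le_sq' (by rwa [sq]) hR.le |>.2

/-- The range of a unital `⋆`-homomorphism of C*-algebras is closed. -/
theorem StarAlgHom.isClosed_range_of_cstar (ρ : M →⋆ₐ[ℂ] N) : IsClosed (Set.range ρ) := by
  have hρ : Continuous ρ := map_continuous ρ
  let f : NormedAddGroupHom M N := 
    { toFun := ρ, map_add' := map_add ρ, bound' := ⟨1, fun v => by
        simpa using NonUnitalStarAlgHom.norm_apply_le ρ v⟩ }
  have hyp : f.SurjectiveOnWith f.range 1 := by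
    rintro _ ⟨y, rfl⟩
    obtain ⟨y', h1, h2⟩ := ρ.exists_lift_norm_le y
    exact ⟨y', h1, by rw [one_mul]; exact h2⟩
  have := controlled_closure_of_complete one_pos one_pos hyp
  refine isClosed_of_closure_subset fun z hz => ?_
  obtain ⟨g, hg, -⟩ := this z (by exact hz)
  exact ⟨g, hg⟩

end ClosedRange

open scoped CStarAlgebra in
/-- A cyclic representation with cyclic vector `ω` whose image contains a nonzero multiple of the
rank-one operator `ω ⊗ ω*` yields an elementary ideal-quotient. -/
theorem HasNonzeroElementaryIdealQuotient.of_cyclic_rankOne {M : Type} [CStarAlgebra M]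
    {H : Type} [NormedAddCommGroup H] [InnerProductSpace ℂ H] [CompleteSpace H]
    (ρ : M →⋆ₐ[ℂ] (H →L[ℂ] H)) {ω : H} (hω : ω ≠ 0) (hcyc : DenseRange fun x => ρ x ω)
    {d : M} {c : ℂ} (hc : c ≠ 0) (hd : ρ d = c • InnerProductSpace.rankOne ℂ ω ω) :
    HasNonzeroElementaryIdealQuotient M := by
  have hρ : Continuous ρ := map_continuous ρ
  have hrange : ∀ T ∈ rankOneClosure H, ∃ x, ρ x = T := by
    have key : rankOneClosure H ≤ LinearMap.range (ρ : M →ₗ[ℂ] (H →L[ℂ] H)) := by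
      refine rankOneClosure_le ρ.isClosed_range_of_cstar fun x y => ?_
      have hcl : IsClosed {q : H × H | InnerProductSpace.rankOne ℂ q.1 q.2 ∈ Set.range ρ} :=
        ρ.isClosed_range_of_cstar.preimage (continuous_rankOne H)
      have : (x, y) ∈ {q : H × H | InnerProductSpace.rankOne ℂ q.1 q.2 ∈ Set.range ρ} := by
        refine hcl.closure_subset_iff.2 ?_ ((hcyc.prodMap hcyc) (x, y))
        rintro _ ⟨⟨a, b⟩, rfl⟩
        refine ⟨c⁻¹ • (a * d * star b), ?_⟩
        rw [map_smul, map_mul, map_mul, map_star, hd, ContinuousLinearMap.star_eq_adjoint]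
        ext v
        simp [hc, ContinuousLinearMap.adjoint_inner_right]
      simpa using this
    exact fun T hT => key hT
  let J : ClosedTwoSidedIdealC M :=
    { carrier :=
        { carrier := {x | ρ x ∈ rankOneClosure H}
          add_mem' := fun {x y} hx hy => by
            simpa using add_mem (S := Submodule ℂ (H →L[ℂ] H)) hx hy
          zero_mem' := by simp
          mul_mem' := fun {x y} _ hy => by simpa using mul_mem_rankOneClosure (ρ x) hy
          smul_mem' := fun r x hx => by simpa using Submodule.smul_mem _ r hx
          star_mem' := fun {x} hx => by
            simpa [map_star] using star_mem_rankOneClosure hx }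
      isClosed := isClosed_rankOneClosure.preimage hρ
      mul_mem_left := fun a x hx => by
        change ρ (a * x) ∈ rankOneClosure H
        simpa using mul_mem_rankOneClosure (ρ a) hx
      mul_mem_right := fun a x hx => by
        change ρ (x * a) ∈ rankOneClosure H
        simpa using mem_rankOneClosure_mul (ρ a) hx }
  refine ⟨J, H, inferInstance, inferInstance, inferInstance,
    (ρ : M →⋆ₙₐ[ℂ] (H →L[ℂ] H)).comp (NonUnitalStarSubalgebraClass.subtype J.carrier), ?_, ?_⟩
  · ext T
    constructor
    · rintro ⟨x, rfl⟩
      exact isCompactOperator_of_mem_rankOneClosure x.2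
    · intro hT
      obtain ⟨x, hx⟩ := hrange T (mem_rankOneClosure_of_isCompactOperator hT)
      refine ⟨⟨x, ?_⟩, hx⟩
      change ρ x ∈ rankOneClosure H
      rw [hx]
      exact mem_rankOneClosure_of_isCompactOperator hT
  · refine ⟨⟨d, ?_⟩, ?_⟩
    · change ρ d ∈ rankOneClosure H
      rw [hd]
      exact Submodule.smul_mem _ _ (rankOne_mem_rankOneClosure _ _)
    · change ρ d ≠ 0
      rw [hd]
      intro h0
      have := congrArg norm h0
      simp [hc, hω, norm_smul] at this

open scoped ComplexOrder InnerProductSpace in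
/-- If the positive functional `f` is a state which is `d`-multiplicative, then the GNS
representation maps `d` to a multiple of a rank-one operator. -/
theorem HasNonzeroElementaryIdealQuotient.of_positiveLinearMap {M : Type} [CStarAlgebra M]
    [PartialOrder M] [StarOrderedRing M] (f : M →ₚ[ℂ] ℂ) (hf : f 1 = 1) {d : M} {c : ℂ}
    (hc : c ≠ 0) (hd : ∀ x y, f (y * d * x) = c * (f y * f x)) :
    HasNonzeroElementaryIdealQuotient M := by
  have hπ : ∀ x b : M, f.gnsStarAlgHom x (f.toPreGNS b : f.GNS) = (f.toPreGNS (x * b) : f.GNS) :=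
    fun x b => f.gnsNonUnitalStarAlgHom_apply_coe
  have hinner : ∀ x y : M, ⟪(f.toPreGNS x : f.GNS), (f.toPreGNS y : f.GNS)⟫_ℂ = f (star x * y) := by
    intro x y
    rw [UniformSpace.Completion.inner_coe, f.preGNS_inner_def]
    rfl
  refine HasNonzeroElementaryIdealQuotient.of_cyclic_rankOne f.gnsStarAlgHom
    (ω := (f.toPreGNS 1 : f.GNS)) ?_ ?_ hc (d := d) ?_
  · intro h0
    have := hinner 1 1
    rw [h0, inner_zero_left, star_one, one_mul, hf] at this
    exact zero_ne_one this
  · have : DenseRange ((↑) : f.PreGNS → f.GNS) := UniformSpace.Completion.denseRange_coe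
    refine Dense.mono ?_ this
    rintro _ ⟨x, rfl⟩
    exact ⟨f.ofPreGNS x, by simp only [hπ, mul_one, f.toPreGNS_ofPreGNS]⟩
  · have hdense : Dense (Set.range fun x : M => (f.toPreGNS x : f.GNS)) := by
      refine Dense.mono ?_ (UniformSpace.Completion.denseRange_coe (α := f.PreGNS))
      rintro _ ⟨x, rfl⟩
      exact ⟨f.ofPreGNS x, rfl⟩
    have key : ∀ x : M, f.gnsStarAlgHom d (f.toPreGNS x : f.GNS) =
        (c • InnerProductSpace.rankOne ℂ (f.toPreGNS 1 : f.GNS) (f.toPreGNS 1 : f.GNS))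
          (f.toPreGNS x : f.GNS) := by
      intro x
      refine hdense.eq_of_inner_right (𝕜 := ℂ) ?_
      rintro _ ⟨y, rfl⟩
      simp only [smul_apply, InnerProductSpace.rankOne_apply, hπ, hinner,
        inner_smul_right, star_one, one_mul, mul_one]
      rw [← mul_assoc, hd]
      ring
    refine DFunLike.coe_injective (Continuous.ext_on hdense (ContinuousLinearMap.continuous _)
      (ContinuousLinearMap.continuous _) ?_)
    rintro _ ⟨x, rfl⟩
    exact key x

section Ideals

variable {M : Type*} [CStarAlgebra M]

theorem IsProjectionElem.norm_le_one {p : M} (hp : IsProjectionElem p) : ‖p‖ ≤ 1 := by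
  have h : ‖p‖ * ‖p‖ = ‖p‖ := by
    rw [← CStarRing.norm_star_mul_self, hp.1.star_eq, hp.2]
  nlinarith [norm_nonneg p]

/-- A projection in the closure of an ideal of a unital C*-algebra lies in the ideal. -/
theorem IsProjectionElem.mem_of_mem_closure {p : M} (hp : IsProjectionElem p) (I : Ideal M)
    [I.IsTwoSided] (h : p ∈ closure (I : Set M)) : p ∈ I := by
  obtain ⟨y, hy, hpy⟩ := Metric.mem_closure_iff.1 h 1 one_pos
  rw [dist_eq_norm] at hpy
  have hn : ‖p * (p - y) * p‖ < 1 := by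
    calc ‖p * (p - y) * p‖ ≤ ‖p‖ * ‖p - y‖ * ‖p‖ :=
          (norm_mul_le _ _).trans (by gcongr; exact norm_mul_le _ _)
      _ ≤ 1 * ‖p - y‖ * 1 := by gcongr <;> exact hp.norm_le_one
      _ < 1 := by simpa using hpy
  obtain ⟨w, hw⟩ := isUnit_one_sub_of_norm_lt_one hn
  have hwp : (w : M) * p = p * y * p := by
    rw [hw, sub_mul, one_mul, mul_assoc _ p p, hp.2, mul_sub, sub_mul, hp.2, hp.2]
    abel
  have : p = ↑w⁻¹ * (p * y * p) := by rw [← hwp, Units.inv_mul_cancel_left]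
  rw [this]
  exact I.mul_mem_left _ (I.mul_mem_right _ (I.mul_mem_left _ hy))

variable {p : M} {I : Ideal M}

/-- Two-sided ideals avoiding `p`. -/
def idealsAvoiding (p : M) : Set (Ideal M) := {I | I.IsTwoSided ∧ p ∉ I}

theorem exists_maximal_idealsAvoiding {I : Ideal M} (hI : I ∈ idealsAvoiding p) :
    ∃ J, I ≤ J ∧ Maximal (· ∈ idealsAvoiding p) J := by
  refine zorn_le_nonempty₀ _ (fun c hc hchain K hK => ?_) I hI
  have hmem : ∀ z, z ∈ sSup c ↔ ∃ J ∈ c, z ∈ J := fun z =>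
    Submodule.mem_sSup_of_directed ⟨K, hK⟩ hchain.directedOn
  refine ⟨sSup c, ⟨⟨fun {a} b ha => ?_⟩, fun hp => ?_⟩, fun J hJ => le_sSup hJ⟩
  · obtain ⟨J, hJ, haJ⟩ := (hmem a).1 ha
    have := (hc hJ).1
    exact (hmem _).2 ⟨J, hJ, J.mul_mem_right b haJ⟩
  · obtain ⟨J, hJ, hpJ⟩ := (hmem p).1 hp
    exact (hc hJ).2 hpJ

theorem isClosed_of_maximal_idealsAvoiding (hp : IsProjectionElem p)
    (hI : Maximal (· ∈ idealsAvoiding p) I) : IsClosed (I : Set M) := by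
  have := hI.prop.1
  have h2 : I.closure.IsTwoSided := ⟨fun {a} b ha =>
    map_mem_closure (f := fun x => x * b) (by fun_prop) ha fun x hx => I.mul_mem_right b hx⟩
  have h3 : I.closure ∈ idealsAvoiding p :=
    ⟨h2, fun h => hI.prop.2 (hp.mem_of_mem_closure I h)⟩
  have : I.closure ≤ I := hI.2 h3 subset_closure
  exact isClosed_of_closure_subset this

theorem mem_or_mem_of_maximal_idealsAvoiding (hp : IsProjectionElem p)
    (hI : Maximal (· ∈ idealsAvoiding p) I) {u v : M} (h : ∀ s, u * s * v ∈ I) :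
    u ∈ I ∨ v ∈ I := by
  have := hI.prop.1
  by_contra! hcon
  have step : ∀ J : Ideal M, J.IsTwoSided → I ≤ J → ∀ x ∈ J, x ∉ I → p ∈ J := by
    intro J hJ hIJ x hx hxI
    by_contra hpJ
    exact hxI (hI.2 ⟨hJ, hpJ⟩ hIJ hx)
  let J₁ : Ideal M :=
    { carrier := {y | ∀ s, u * s * y ∈ I}
      add_mem' := fun {a b} ha hb s => by rw [mul_add]; exact I.add_mem (ha s) (hb s)
      zero_mem' := fun s => by simp
      smul_mem' := fun a y hy s => by
        have := hy (s * a)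
        rwa [smul_eq_mul, ← mul_assoc, mul_assoc u s a] }
  have hp₁ : p ∈ J₁ := step J₁ ⟨fun {a} b ha s => by
    rw [← mul_assoc]; exact I.mul_mem_right b (ha s)⟩ (fun y hy s => I.mul_mem_left _ hy) v h hcon.2
  let J₂ : Ideal M :=
    { carrier := {y | ∀ s, y * s * p ∈ I}
      add_mem' := fun {a b} ha hb s => by
        rw [add_mul, add_mul]; exact I.add_mem (ha s) (hb s)
      zero_mem' := fun s => by simp
      smul_mem' := fun a y hy s => by
        rw [smul_eq_mul, mul_assoc, mul_assoc, ← mul_assoc y]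
        exact I.mul_mem_left _ (hy s) }
  have hp₂ : p ∈ J₂ := step J₂ ⟨fun {a} b ha s => by
    have := ha (b * s)
    rwa [← mul_assoc] at this⟩
    (fun y hy s => I.mul_mem_right _ (I.mul_mem_right _ hy)) u hp₁ hcon.1
  have := hp₂ 1
  rw [mul_one, hp.2] at this
  exact hI.prop.2 this

/-- A closed left ideal containing `y⋆ y` contains `y`. -/
theorem Ideal.mem_of_star_mul_self_mem (hI : IsClosed (I : Set M)) {y : M}
    (hy : star y * y ∈ I) : y ∈ I := by
  refine hI.closure_subset (Metric.mem_closure_iff.2 fun ε hε => ?_)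
  obtain ⟨δ, hδ, hδε⟩ : ∃ δ > 0, δ < ε ^ 2 := ⟨ε ^ 2 / 2, by positivity, by
    have : 0 < ε ^ 2 := by positivity
    linarith⟩
  obtain ⟨g, hg⟩ : ∃ g, g = star y * y := ⟨_, rfl⟩
  have hsa : IsSelfAdjoint g := hg ▸ IsSelfAdjoint.star_mul_self y
  have hspec : ∀ t ∈ spectrum ℝ g, 0 ≤ t := by
    rw [hg]
    exact spectrum_star_mul_self_nonneg
  obtain ⟨k, hk⟩ : ∃ k : ℝ → ℝ, ∀ t, k t = (δ + |t|)⁻¹ := ⟨_, fun _ => rfl⟩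
  have hpos : ∀ t : ℝ, 0 < δ + |t| := fun t => by positivity
  have hkc : Continuous k := by
    rw [funext hk]
    exact Continuous.inv₀ (by fun_prop) fun t => (hpos t).ne'
  have hkc' := hkc.continuousOn (s := spectrum ℝ g)
  have hh : ContinuousOn (fun t => δ * k t) (spectrum ℝ g) := continuousOn_const.mul hkc'
  refine ⟨y * (cfc k g * g), ?_, ?_⟩
  · rw [← hg] at hy
    exact I.mul_mem_left _ (I.mul_mem_left _ hy)
  have h1 : 1 - cfc k g * g = cfc (fun t => δ * k t) g := by
    have : cfc k g * g = cfc (fun t => k t * t) g := by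
      rw [cfc_mul k (fun t => t) g hkc' continuousOn_id, cfc_id' ℝ g hsa]
    rw [this, ← cfc_const_one ℝ g hsa, 
      ← cfc_sub (fun _ => 1) (fun t => k t * t) g continuousOn_const (hkc'.mul continuousOn_id)]
    refine cfc_congr fun t ht => ?_
    have := hpos t
    have h0 := abs_of_nonneg (hspec t ht)
    simp only [hk, h0] at this ⊢
    field_simp
    ring
  have h2 : y - y * (cfc k g * g) = y * cfc (fun t => δ * k t) g := by
    rw [← h1, mul_sub, mul_one]
  rw [dist_eq_norm, h2]
  have hsc : star (cfc (fun t => δ * k t) g) = cfc (fun t => δ * k t) g :=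
    cfc_predicate (R := ℝ) (p := IsSelfAdjoint) _ g
  have h3 : ‖y * cfc (fun t => δ * k t) g‖ ^ 2 ≤ δ := by
    rw [sq, ← CStarRing.norm_star_mul_self, star_mul, hsc]
    have : cfc (fun t => δ * k t) g * star y * (y * cfc (fun t => δ * k t) g) =
        cfc (fun t => δ * k t * t * (δ * k t)) g := by
      rw [cfc_mul (fun t => δ * k t * t) (fun t => δ * k t) g (hh.mul continuousOn_id) hh,
        cfc_mul (fun t => δ * k t) (fun t => t) g hh continuousOn_id, cfc_id' ℝ g hsa, hg]
      simp only [mul_assoc]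
    rw [this]
    refine norm_cfc_le hδ.le fun t ht => ?_
    have ht0 := hspec t ht
    have := hpos t
    simp only [hk, abs_of_nonneg ht0] at this ⊢
    rw [Real.norm_of_nonneg (by positivity)]
    have e1 : δ * (δ + t)⁻¹ ≤ 1 := by
      rw [← div_eq_mul_inv, div_le_one this]; linarith
    have e2 : t * (δ + t)⁻¹ ≤ 1 := by
      rw [← div_eq_mul_inv, div_le_one this]; linarith
    calc δ * (δ + t)⁻¹ * t * (δ * (δ + t)⁻¹)
        = δ * ((δ * (δ + t)⁻¹) * (t * (δ + t)⁻¹)) := by ring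
      _ ≤ δ * (1 * 1) := by gcongr
      _ = δ := by ring
  exact lt_of_pow_lt_pow_left₀ 2 hε.le (h3.trans_lt hδε)

end Ideals

section Compression

variable {M : Type} [CStarAlgebra M] [PartialOrder M] [StarOrderedRing M] {I : Ideal M}

/-- If the positive or the negative part of each self-adjoint element `d x d` lies in the closed
ideal `I`, then for positive `x` the element `d x d` is modulo `I` a multiple of `d²`. -/
theorem exists_nonneg_sub_smul_mem (hI : IsClosed (I : Set M)) {d : M} (hd : IsSelfAdjoint d)
    (hdich : ∀ x : M, IsSelfAdjoint x → (d * x * d)⁺ ∈ I ∨ (d * x * d)⁻ ∈ I) {x : M}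
    (hx : 0 ≤ x) : ∃ t : ℝ, 0 ≤ t ∧ d * x * d - (t : ℂ) • (d * d) ∈ I := by
  have hxsa : IsSelfAdjoint x := hx.isSelfAdjoint
  let Y : ℝ → M := fun t => d * (x - algebraMap ℝ M t) * d
  have hsa : ∀ t, IsSelfAdjoint (x - algebraMap ℝ M t) := fun t =>
    hxsa.sub (IsSelfAdjoint.algebraMap M (IsSelfAdjoint.all t))
  have hYsa : ∀ t, IsSelfAdjoint (Y t) := fun t => by
    have := (hsa t).conjugate d
    rwa [hd.star_eq] at this
  have hYc : Continuous Y := by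
    have : Continuous fun t : ℝ => algebraMap ℝ M t := continuous_algebraMap ℝ M
    fun_prop
  have hpos : Continuous fun t => (Y t)⁺ := by
    simp only [CFC.posPart_def]
    exact Continuous.cfcₙ_of_mem_nhdsSet (p := IsSelfAdjoint) (s := Set.univ) _ univ_mem hYc hYsa
      (continuous_posPart.continuousOn)
  have hneg : Continuous fun t => (Y t)⁻ := by
    simp only [CFC.negPart_def]
    exact Continuous.cfcₙ_of_mem_nhdsSet (p := IsSelfAdjoint) (s := Set.univ) _ univ_mem hYc hYsa
      (continuous_negPart.continuousOn)
  have hconn := isPreconnected_closed_iff.1 (isPreconnected_Icc (a := (0 : ℝ)) (b := ‖x‖))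
    {t | (Y t)⁺ ∈ I} {t | (Y t)⁻ ∈ I} (hI.preimage hpos) (hI.preimage hneg)
    (fun t _ => hdich _ (hsa t)) ?_ ?_
  · obtain ⟨t, ht, h1, h2⟩ := hconn
    refine ⟨t, ht.1, ?_⟩
    have h3 : Y t ∈ I := by
      rw [← CFC.posPart_sub_negPart (Y t) (hYsa t)]
      exact I.sub_mem h1 h2
    have : Y t = d * x * d - (t : ℂ) • (d * d) := by
      simp only [Y]
      rw [mul_sub, sub_mul, Algebra.algebraMap_eq_smul_one, mul_smul_comm, smul_mul_assoc, mul_one]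
      simp
    rwa [← this]
  · refine ⟨‖x‖, ⟨norm_nonneg x, le_rfl⟩, ?_⟩
    have h1 : x - algebraMap ℝ M ‖x‖ ≤ 0 := by
      rw [sub_nonpos]
      exact IsSelfAdjoint.le_algebraMap_norm_self hxsa
    have h2 : Y ‖x‖ ≤ 0 := by
      have := star_left_conjugate_le_conjugate h1 d
      rwa [hd.star_eq, mul_zero, zero_mul] at this
    have : (Y ‖x‖)⁺ = 0 := (CFC.posPart_eq_zero_iff _ (hYsa _)).2 h2
    simp [this]
  · refine ⟨0, ⟨le_rfl, norm_nonneg x⟩, ?_⟩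
    have h2 : 0 ≤ Y 0 := by
      have := star_left_conjugate_nonneg hx d
      rw [hd.star_eq] at this
      simpa [Y] using this
    have : (Y 0)⁻ = 0 := (CFC.negPart_eq_zero_iff _ (hYsa _)).2 h2
    simp [this]

open scoped ComplexOrder in
theorem HasNonzeroElementaryIdealQuotient.of_compression (hI : IsClosed (I : Set M))
    [I.IsTwoSided] {d : M} (hd : IsSelfAdjoint d) (hdI : d ∉ I)
    (hdich : ∀ x : M, IsSelfAdjoint x → (d * x * d)⁺ ∈ I ∨ (d * x * d)⁻ ∈ I) :
    HasNonzeroElementaryIdealQuotient M := by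
  have hsmul : ∀ (c : ℂ) (x : M), x ∈ I → c • x ∈ I := fun c x hx => by
    rw [← one_mul x, ← smul_mul_assoc]
    exact I.mul_mem_left _ hx
  have hd2 : d * d ∉ I := fun h => hdI (Ideal.mem_of_star_mul_self_mem hI (by rwa [hd.star_eq]))
  have hd4 : d * d * (d * d) ∉ I := fun h => hd2 (Ideal.mem_of_star_mul_self_mem hI (by
    rwa [star_mul, hd.star_eq]))
  have huniq : ∀ (c c' : ℂ) (x : M), x - c • (d * d) ∈ I → x - c' • (d * d) ∈ I → c = c' := by
    intro c c' x h h'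
    by_contra hne
    have h1 := I.sub_mem h' h
    rw [sub_sub_sub_cancel_left, ← sub_smul] at h1
    have h2 := hsmul (c - c')⁻¹ _ h1
    rw [smul_smul, inv_mul_cancel₀ (sub_ne_zero.2 hne), one_smul] at h2
    exact hd2 h2
  have hex : ∀ x : M, ∃ c : ℂ, d * x * d - c • (d * d) ∈ I := by
    intro x
    have hx : x ∈ Submodule.span ℂ {a : M | 0 ≤ a} := by
      rw [CStarAlgebra.span_nonneg]
      trivial
    induction hx using Submodule.span_induction with
    | mem x hx =>
      obtain ⟨t, -, ht⟩ := exists_nonneg_sub_smul_mem hI hd hdich hx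
      exact ⟨t, ht⟩
    | zero => exact ⟨0, by simp⟩
    | add x y _ _ hx hy =>
      obtain ⟨a, ha⟩ := hx
      obtain ⟨b, hb⟩ := hy
      refine ⟨a + b, ?_⟩
      have : d * (x + y) * d - (a + b) • (d * d) =
          (d * x * d - a • (d * d)) + (d * y * d - b • (d * d)) := by
        rw [mul_add, add_mul, add_smul]; abel
      rw [this]
      exact I.add_mem ha hb
    | smul c x _ hx =>
      obtain ⟨a, ha⟩ := hx
      refine ⟨c * a, ?_⟩
      have : d * (c • x) * d - (c * a) • (d * d) = c • (d * x * d - a • (d * d)) := by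
        rw [mul_smul_comm, smul_mul_assoc, smul_sub, smul_smul]
      rw [this]
      exact hsmul _ _ ha
  choose φ hφ using hex
  let f₀ : M →ₗ[ℂ] ℂ :=
    { toFun := φ
      map_add' := fun x y => huniq _ _ (d * (x + y) * d) (hφ _) (by
        have : d * (x + y) * d - (φ x + φ y) • (d * d) =
            (d * x * d - φ x • (d * d)) + (d * y * d - φ y • (d * d)) := by
          rw [mul_add, add_mul, add_smul]; abel
        rw [this]
        exact I.add_mem (hφ x) (hφ y))
      map_smul' := fun c x => huniq _ _ (d * (c • x) * d) (hφ _) (by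
        have : d * (c • x) * d - (c * φ x) • (d * d) = c • (d * x * d - φ x • (d * d)) := by
          rw [mul_smul_comm, smul_mul_assoc, smul_sub, smul_smul]
        rw [RingHom.id_apply, smul_eq_mul, this]
        exact hsmul _ _ (hφ x)) }
  let f : M →ₚ[ℂ] ℂ := PositiveLinearMap.mk₀ f₀ fun x hx => by
    obtain ⟨t, ht0, ht⟩ := exists_nonneg_sub_smul_mem hI hd hdich hx
    have : f₀ x = t := huniq _ _ _ (hφ x) ht
    rw [this]
    exact_mod_cast ht0
  refine HasNonzeroElementaryIdealQuotient.of_positiveLinearMap f (d := d * d) (c := φ (d * d))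
    ?_ ?_ ?_
  · exact huniq (φ 1) 1 (d * 1 * d) (hφ 1) (by simp)
  · intro h0
    have := hφ (d * d)
    rw [h0, zero_smul, sub_zero] at this
    exact hd4 (by simpa only [mul_assoc] using this)
  · intro x y
    refine huniq (φ (y * (d * d) * x)) _ _ (hφ _) ?_
    have : d * (y * (d * d) * x) * d - (φ (d * d) * (φ y * φ x)) • (d * d) =
        (d * y * d - φ y • (d * d)) * (d * x * d) +
        φ y • ((d * d) * (d * x * d - φ x • (d * d))) +
        (φ y * φ x) • (d * (d * d) * d - φ (d * d) • (d * d)) := by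
      simp only [sub_mul, mul_sub, smul_sub, smul_mul_assoc, mul_smul_comm, smul_smul, mul_assoc]
      rw [mul_comm (φ (d * d)), mul_assoc]
      abel
    change _ - (φ (d * d) * (φ y * φ x)) • (d * d) ∈ I
    rw [this]
    exact I.add_mem (I.add_mem (I.mul_mem_right _ (hφ y)) (hsmul _ _ (I.mul_mem_left _ (hφ x))))
      (hsmul _ _ (hφ (d * d)))

end Compression

section Systems

/-- A family of elements of `p M` which are orthogonal with common square `e = vᵢ⋆ vᵢ ∈ p M p`. -/
structure IsOrthogonalSystem {M : Type*} [CStarAlgebra M] (p : M) {ι : Type*} [DecidableEq ι]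
    (v : ι → M) (e : M) : Prop where
  isSelfAdjoint : IsSelfAdjoint e
  mul_right : e * p = e
  mul_left : ∀ i, p * v i = v i
  star_mul_apply : ∀ i j, star (v i) * v j = if i = j then e else 0

namespace IsOrthogonalSystem

variable {M : Type*} [CStarAlgebra M] {p e : M} {ι κ : Type*} [DecidableEq ι]
  [DecidableEq κ] {v : ι → M}

theorem star_mul_self (h : IsOrthogonalSystem p v e) (i : ι) : star (v i) * v i = e := by
  simp [h.star_mul_apply]

theorem comp (h : IsOrthogonalSystem p v e) {f : κ → ι} (hf : Function.Injective f) :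
    IsOrthogonalSystem p (v ∘ f) e where
  isSelfAdjoint := h.isSelfAdjoint
  mul_right := h.mul_right
  mul_left i := h.mul_left (f i)
  star_mul_apply i j := by simp [h.star_mul_apply, hf.eq_iff]

theorem apply_mul_right (h : IsOrthogonalSystem p v e) (i : ι) :
    v i * p = v i := by
  have h1 : star (v i * (1 - p)) * (v i * (1 - p)) = 0 := by
    have : star (v i * (1 - p)) * (v i * (1 - p)) =
        star (1 - p) * (star (v i) * v i * (1 - p)) := by
      rw [star_mul]; simp only [mul_assoc]
    rw [this, h.star_mul_self, mul_sub, mul_one, h.mul_right, sub_self, mul_zero]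
  have h2 := CStarRing.star_mul_self_eq_zero_iff _ |>.1 h1
  rw [mul_sub, mul_one, sub_eq_zero] at h2
  exact h2.symm

/-- Cutting down a system by functional calculus: the new square `u` acts as a unit on
`(e - ε)₊`. -/
theorem exists_cutdown (h : IsOrthogonalSystem p v e) {ε : ℝ} (hε : 0 < ε) :
    ∃ (v' : ι → M) (u : M), IsOrthogonalSystem p v' u ∧
      u * cfc (fun t : ℝ => max (t - ε) 0) e = cfc (fun t : ℝ => max (t - ε) 0) e := by
  obtain ⟨k, hk⟩ : ∃ k : ℝ → ℝ, ∀ t, k t = (√(max t ε))⁻¹ := ⟨_, fun _ => rfl⟩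
  have hpos : ∀ t : ℝ, 0 < √(max t ε) := fun t =>
    Real.sqrt_pos.2 (lt_of_lt_of_le hε (le_max_right _ _))
  have hkc : Continuous k := by
    rw [funext hk]
    exact Continuous.inv₀ (by fun_prop) fun t => (hpos t).ne'
  have hkc' := hkc.continuousOn (s := spectrum ℝ e)
  have hsa := h.isSelfAdjoint
  have hkk : ContinuousOn (fun t => k t * k t * t) (spectrum ℝ e) :=
    (hkc'.mul hkc').mul continuousOn_id
  have hsc : star (cfc k e) = cfc k e := cfc_predicate (R := ℝ) (p := IsSelfAdjoint) k e
  have hu : cfc (fun t => k t * k t * t) e = cfc k e * cfc k e * e := by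
    rw [cfc_mul (fun t => k t * k t) (fun t => t) e (hkc'.mul hkc') continuousOn_id,
      cfc_mul k k e hkc' hkc', cfc_id' ℝ e hsa]
  have hcomm : cfc k e * e = e * cfc k e := by
    have h1 := cfc_commute_cfc k (fun t => t) e
    rw [cfc_id' ℝ e hsa] at h1
    exact h1
  refine ⟨fun i => v i * cfc k e, cfc (fun t => k t * k t * t) e, ⟨?_, ?_, ?_, ?_⟩, ?_⟩
  · exact cfc_predicate (R := ℝ) (p := IsSelfAdjoint) _ e
  · rw [hu, mul_assoc, h.mul_right]
  · intro i
    rw [← mul_assoc, h.mul_left]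
  · intro i j
    have : star (v i * cfc k e) * (v j * cfc k e) =
        cfc k e * (star (v i) * v j) * cfc k e := by
      rw [star_mul, hsc]; simp only [mul_assoc]
    rw [this, h.star_mul_apply, hu]
    split_ifs
    · rw [mul_assoc, ← hcomm, mul_assoc]
    · simp
  · have hd : ContinuousOn (fun t : ℝ => max (t - ε) 0) (spectrum ℝ e) := by fun_prop
    rw [← cfc_mul (fun t => k t * k t * t) _ e hkk hd]
    refine cfc_congr fun t _ => ?_
    simp only [hk]
    rcases le_total t ε with ht | ht
    · simp [ht]
    · have h0 : 0 < t := hε.trans_le ht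
      rw [max_eq_left ht, ← mul_inv, Real.mul_self_sqrt h0.le, inv_mul_cancel₀ h0.ne', one_mul]

theorem _root_.mul_eq_self_of_mul_mul_self {u a : M} (ha : IsSelfAdjoint a)
    (h : u * (a * a) = a * a) : u * a = a := by
  have h1 : ((u - 1) * a) * star ((u - 1) * a) = 0 := by
    have : ((u - 1) * a) * star ((u - 1) * a) = (u - 1) * (a * a) * star (u - 1) := by
      rw [star_mul, ha.star_eq]; simp only [mul_assoc]
    rw [this, sub_mul, h, one_mul, sub_self, zero_mul]
  have h2 := CStarRing.mul_star_self_eq_zero_iff _ |>.1 h1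
  rwa [sub_mul, one_mul, sub_eq_zero] at h2

section Order

variable [PartialOrder M] [StarOrderedRing M]

/-- A square-zero element in the corner of a system doubles the size of the system. -/
theorem double {u z : M} (h : IsOrthogonalSystem p v u) (huz : u * z = z) (hzu : z * u = z)
    (hz : z * z = 0) :
    IsOrthogonalSystem p (Sum.elim (fun i => v i * z) fun i => v i * CFC.abs z)
      (star z * z) := by
  have hb : star (CFC.abs z) = CFC.abs z := (CFC.abs_nonneg z).isSelfAdjoint
  have hbb : CFC.abs z * CFC.abs z = star z * z := CFC.abs_mul_abs z
  have huzs : u * star z = star z := by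
    have := congrArg star hzu
    rwa [star_mul, h.isSelfAdjoint.star_eq] at this
  have hub : u * CFC.abs z = CFC.abs z := by
    refine mul_eq_self_of_mul_mul_self hb ?_
    rw [hbb, ← mul_assoc, huzs]
  have hzb : star z * CFC.abs z = 0 := by
    refine CStarRing.mul_star_self_eq_zero_iff _ |>.1 ?_
    rw [star_mul, star_star, hb]
    have : star z * CFC.abs z * (CFC.abs z * z) = star z * (CFC.abs z * CFC.abs z) * z := by
      simp only [mul_assoc]
    rw [this, hbb, mul_assoc, mul_assoc, hz, mul_zero, mul_zero]
  have hbz : CFC.abs z * z = 0 := by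
    have := congrArg star hzb
    rwa [star_mul, star_star, hb, star_zero] at this
  have key : ∀ i j (a b : M), u * b = b →
      star (v i * a) * (v j * b) = if i = j then star a * b else 0 := by
    intro i j a b hub
    have : star (v i * a) * (v j * b) = star a * (star (v i) * v j * b) := by
      rw [star_mul]; simp only [mul_assoc]
    rw [this, h.star_mul_apply]
    split_ifs <;> simp [hub]
  refine ⟨IsSelfAdjoint.star_mul_self z, ?_, ?_, ?_⟩
  · rw [mul_assoc, ← hzu, mul_assoc z, h.mul_right]
  · rintro (i | i) <;> simp only [Sum.elim_inl, Sum.elim_inr] <;> rw [← mul_assoc, h.mul_left]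
  · rintro (i | i) (j | j)
    · simpa using key i j z z huz
    · simpa [hzb] using key i j z _ hub
    · simpa [hb, hbz] using key i j (CFC.abs z) z huz
    · simpa [hb, hbb] using key i j (CFC.abs z) (CFC.abs z) hub

end Order

end IsOrthogonalSystem

variable {M : Type} [CStarAlgebra M] [PartialOrder M] [StarOrderedRing M]

/-- Modulo a maximal ideal avoiding the projection `p` of a nowhere scattered C*-algebra, systems
can be doubled. -/
theorem exists_double_system (hns : NowhereScattered M) {p : M} (hp : IsProjectionElem p)
    {I : Ideal M} (hI : Maximal (· ∈ idealsAvoiding p) I) {ι : Type*} [DecidableEq ι]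
    {v : ι → M} {e : M} (h : IsOrthogonalSystem p v e) (he0 : 0 ≤ e) (he : e ∉ I) :
    ∃ (w : ι ⊕ ι → M) (e' : M), IsOrthogonalSystem p w e' ∧ e' ∉ I := by
  have hcl := isClosed_of_maximal_idealsAvoiding hp hI
  have := hI.prop.1
  obtain ⟨ε, hε, hdI⟩ : ∃ ε : ℝ, 0 < ε ∧ cfc (fun t : ℝ => max (t - ε) 0) e ∉ I := by
    by_contra! hcon
    refine he (hcl.closure_subset (Metric.mem_closure_iff.2 fun ε hε => ?_))
    refine ⟨_, hcon (ε / 2) (half_pos hε), ?_⟩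
    rw [dist_eq_norm]
    refine lt_of_le_of_lt ?_ (half_lt_self hε)
    nth_rewrite 1 [← cfc_id' ℝ e h.isSelfAdjoint]
    rw [← cfc_sub (fun t => t) (fun t : ℝ => max (t - ε / 2) 0) e (by fun_prop) (by fun_prop)]
    refine norm_cfc_le (half_pos hε).le fun t ht => ?_
    have ht0 : 0 ≤ t := spectrum_nonneg_of_nonneg he0 ht
    rw [Real.norm_eq_abs, abs_le]
    rcases le_total t (ε / 2) with h1 | h1
    · rw [max_eq_right (by linarith)]
      constructor <;> linarith
    · rw [max_eq_left (by linarith)]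
      constructor <;> linarith
  obtain ⟨v', u, hv', hud⟩ := h.exists_cutdown hε
  set d := cfc (fun t : ℝ => max (t - ε) 0) e with hd
  have hdsa : IsSelfAdjoint d := cfc_predicate (R := ℝ) (p := IsSelfAdjoint) _ e
  by_contra! hno
  refine hns (HasNonzeroElementaryIdealQuotient.of_compression hcl hdsa hdI fun x hx => ?_)
  set y := d * x * d with hy
  have hysa : IsSelfAdjoint y := by
    have := hx.conjugate d
    rwa [hdsa.star_eq] at this
  have huy : u * y = y := by rw [hy, ← mul_assoc, ← mul_assoc, hud]
  have hsub := CFC.posPart_sub_negPart y hysa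
  have hpsa : IsSelfAdjoint y⁺ := (CFC.posPart_nonneg y).isSelfAdjoint
  have hnsa : IsSelfAdjoint y⁻ := (CFC.negPart_nonneg y).isSelfAdjoint
  have hup : u * y⁺ = y⁺ := by
    refine mul_eq_self_of_mul_mul_self hpsa ?_
    have : y⁺ * y⁺ = y * y⁺ := by
      have := congrArg (· * y⁺) hsub
      simpa only [sub_mul, CFC.negPart_mul_posPart, sub_zero] using this
    rw [this, ← mul_assoc, huy]
  have hun : u * y⁻ = y⁻ := by
    refine mul_eq_self_of_mul_mul_self hnsa ?_
    have : y⁻ * y⁻ = - (y * y⁻) := by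
      have := congrArg (fun a => -(a * y⁻)) hsub
      simpa only [sub_mul, CFC.posPart_mul_negPart, zero_sub, neg_neg] using this
    rw [this, mul_neg, ← mul_assoc, huy]
  refine mem_or_mem_of_maximal_idealsAvoiding hp hI fun s => ?_
  by_contra hz
  have hnu : y⁻ * u = y⁻ := by
    have := congrArg star hun
    rwa [star_mul, hnsa.star_eq, hv'.isSelfAdjoint.star_eq] at this
  refine hz (Ideal.mem_of_star_mul_self_mem hcl (hno _ _ (hv'.double ?_ ?_ ?_)))
  · rw [← mul_assoc, ← mul_assoc, hup]
  · rw [mul_assoc, hnu]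
  · have : y⁺ * s * y⁻ * (y⁺ * s * y⁻) = y⁺ * s * (y⁻ * y⁺) * (s * y⁻) := by
      simp only [mul_assoc]
    rw [this, CFC.negPart_mul_posPart, mul_zero, zero_mul]

/-- In a nowhere scattered unital C*-algebra, every projection is dominated by a finite sum of
conjugates of squares of systems of `m` orthogonal elements under the projection. -/
theorem exists_le_sum_of_nowhereScattered (hns : NowhereScattered M) {p : M}
    (hp : IsProjectionElem p) {m : ℕ} (hm : 0 < m) :
    ∃ (κ : Type) (_ : Fintype κ) (e s : κ → M) (v : κ → Fin m → M),
      (∀ j, IsOrthogonalSystem p (v j) (e j)) ∧ p ≤ ∑ j, s j * e j * star (s j) := by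
  let Q : M → Prop := fun y => ∃ (κ : Type) (_ : Fintype κ) (e s : κ → M) (v : κ → Fin m → M),
      (∀ j, IsOrthogonalSystem p (v j) (e j)) ∧ y + star y ≤ ∑ j, s j * e j * star (s j)
  have hnonneg : ∀ (v : Fin m → M) (e : M), IsOrthogonalSystem p v e → 0 ≤ e := by
    intro v e h
    rw [← h.star_mul_self ⟨0, hm⟩]
    exact star_mul_self_nonneg _
  have hadd : ∀ y z, Q y → Q z → Q (y + z) := by
    rintro y z ⟨κ, _, e, s, v, h, hy⟩ ⟨κ', _, e', s', v', h', hz⟩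
    refine ⟨κ ⊕ κ', inferInstance, Sum.elim e e', Sum.elim s s', Sum.elim v v', ?_, ?_⟩
    · rintro (j | j)
      · exact h j
      · exact h' j
    · rw [Fintype.sum_sum_type, star_add, add_add_add_comm]
      exact add_le_add hy hz
  have hmem : ∀ (v : Fin m → M) (e : M), IsOrthogonalSystem p v e → ∀ s t, Q (s * e * t) := by
    intro v e h s t
    refine ⟨Fin 2, inferInstance, ![e, e], ![s, star t], ![v, v], ?_, ?_⟩
    · intro j
      fin_cases j <;> exact h
    · rw [Fin.sum_univ_two]
      have h1 := star_right_conjugate_nonneg (hnonneg v e h) (s - star t)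
      rw [← sub_nonneg]
      convert h1 using 1
      simp only [star_mul, star_sub, star_star, h.isSelfAdjoint.star_eq, Matrix.cons_val_zero,
        Matrix.cons_val_one]
      noncomm_ring
  let I₀ : Ideal M :=
    { carrier := {y | ∀ s t, Q (s * y * t)}
      add_mem' := fun {a b} ha hb s t => by
        rw [mul_add, add_mul]; exact hadd _ _ (ha s t) (hb s t)
      zero_mem' := fun s t => by
        refine ⟨Fin 0, inferInstance, ![], ![], ![], fun j => j.elim0, ?_⟩
        simp
      smul_mem' := fun a y hy s t => by
        rw [smul_eq_mul, ← mul_assoc]; exact hy _ _ }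
  by_cases hpI : p ∈ I₀
  · obtain ⟨κ, _, e, s, v, h, hle⟩ := hpI 1 1
    refine ⟨κ, inferInstance, e, s, v, h, le_trans ?_ hle⟩
    rw [one_mul, mul_one, hp.1.star_eq]
    refine le_add_of_nonneg_left ?_
    rw [← hp.2]
    nth_rewrite 1 [← hp.1.star_eq]
    exact star_mul_self_nonneg p
  · exfalso
    obtain ⟨I, hle, hI⟩ := exists_maximal_idealsAvoiding (p := p) (I := I₀)
      ⟨⟨fun {a} b ha s t => by
        rw [← mul_assoc, mul_assoc]; exact ha s (b * t)⟩, hpI⟩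
    have hpow : ∀ k : ℕ, ∃ (v : Fin (2 ^ k) → M) (e : M), IsOrthogonalSystem p v e ∧ e ∉ I := by
      intro k
      induction k with
      | zero =>
        refine ⟨fun _ => p, p, ⟨hp.1, hp.2, fun _ => hp.2, fun i j => ?_⟩, hI.prop.2⟩
        rw [if_pos (Subsingleton.elim (α := Fin 1) i j), hp.1.star_eq, hp.2]
      | succ k ih =>
        obtain ⟨v, e, h, he⟩ := ih
        obtain ⟨w, e', hw, he'⟩ := exists_double_system hns hp hI h
          (h.star_mul_self ⟨0, by positivity⟩ ▸ star_mul_self_nonneg _) he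
        have hcard : 2 ^ (k + 1) = 2 ^ k + 2 ^ k := by ring
        exact ⟨_, e', hw.comp (f := (finSumFinEquiv.symm : _ → _) ∘ Fin.cast hcard)
          (finSumFinEquiv.symm.injective.comp (Fin.cast_injective hcard)), he'⟩
    obtain ⟨v, e, h, he⟩ := hpow m
    have h' := h.comp (Fin.castLE_injective (Nat.lt_two_pow_self (n := m)).le)
    exact he (hle fun s t => hmem _ _ h' s t)

end Systems

section CuntzComparison

section Basic

variable {T : Type*} [NonUnitalCStarAlgebra T]

theorem cuntzBelow_iff_mem_closure {a b : T} :
    CuntzBelow a b ↔ a ∈ closure (Set.range fun r : T => r * b * star r) := by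
  rw [mem_closure_iff_seq_limit]
  constructor
  · rintro ⟨r, hr⟩
    exact ⟨_, fun n => ⟨r n, rfl⟩, hr⟩
  · rintro ⟨f, hf, hlim⟩
    choose r hr using hf
    exact ⟨r, by simpa only [hr] using hlim⟩

theorem CuntzBelow.of_mem_closure {h c : T} (hh : h ∈ closure (Set.range fun r : T => r * c)) :
    CuntzBelow (h * star h) (c * star c) := by
  rw [cuntzBelow_iff_mem_closure]
  have hc : Continuous fun z : T => z * star z := by fun_prop
  refine closure_mono ?_ (image_closure_subset_closure_image hc ⟨h, hh, rfl⟩)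
  rintro _ ⟨_, ⟨r, rfl⟩, rfl⟩
  exact ⟨r, by simp only [star_mul, mul_assoc]⟩

theorem CuntzBelow.of_star_mem_closure {h c : T}
    (hh : star h ∈ closure (Set.range fun r : T => c * r)) :
    CuntzBelow (h * star h) (star c * c) := by
  have := CuntzBelow.of_mem_closure (h := h) (c := star c) ?_
  · simpa using this
  refine closure_mono ?_
    (image_closure_subset_closure_image continuous_star ⟨star h, hh, star_star h⟩)
  rintro _ ⟨_, ⟨r, rfl⟩, rfl⟩
  exact ⟨star r, by simp⟩

theorem CStarNonneg.star_mul_self (a : T) : CStarNonneg (star a * a) := ⟨a, rfl⟩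

theorem CStarNonneg.mul_star_self (a : T) : CStarNonneg (a * star a) := ⟨star a, by simp⟩

theorem CStarNonneg.add {a b : T} (ha : CStarNonneg a) (hb : CStarNonneg b) :
    CStarNonneg (a + b) := by
  let _ := CStarAlgebra.spectralOrder T
  let _ := CStarAlgebra.spectralOrderedRing T
  have h : ∀ c : T, CStarNonneg c ↔ 0 ≤ c := fun c =>
    CStarAlgebra.nonneg_iff_eq_star_mul_self.symm
  rw [h] at *
  exact add_nonneg ha hb

theorem CStarNonneg.sum {κ : Type*} (s : Finset κ) {a : κ → T} (ha : ∀ i, CStarNonneg (a i)) :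
    CStarNonneg (∑ i ∈ s, a i) := by
  classical
  induction s using Finset.induction_on with
  | empty => exact ⟨0, by simp⟩
  | insert i s his ih => rw [Finset.sum_insert his]; exact (ha i).add ih

theorem CStarNonneg.exists_sqrt {a : T} (ha : CStarNonneg a) :
    ∃ h : T, IsSelfAdjoint h ∧ h * h = a := by
  let _ := CStarAlgebra.spectralOrder T
  let _ := CStarAlgebra.spectralOrderedRing T
  have h0 : 0 ≤ a := CStarAlgebra.nonneg_iff_eq_star_mul_self.2 ha
  exact ⟨CFC.sqrt a, (CFC.sqrt_nonneg a).isSelfAdjoint, CFC.sqrt_mul_sqrt_self a⟩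

end Basic

/-- An embedding of a C⋆-algebra as an ideal of a unital C⋆-algebra. -/
structure IsIdealEmbedding {T M : Type*} [NonUnitalCStarAlgebra T] [CStarAlgebra M]
    (ι : T →⋆ₙₐ[ℂ] M) : Prop where
  injective : Function.Injective ι
  exists_mul_left : ∀ (b : M) (t : T), ∃ t', ι t' = b * ι t

namespace IsIdealEmbedding

variable {T M : Type*} [NonUnitalCStarAlgebra T] [CStarAlgebra M] {ι : T →⋆ₙₐ[ℂ] M}

theorem isometry (hι : IsIdealEmbedding ι) : Isometry ι :=
  NonUnitalStarAlgHom.isometry ι hι.injective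

theorem exists_mul_right (hι : IsIdealEmbedding ι) (b : M) (t : T) : ∃ t', ι t' = ι t * b := by
  obtain ⟨t', ht'⟩ := hι.exists_mul_left (star b) (star t)
  exact ⟨star t', by rw [map_star, ht', star_mul, map_star, star_star, star_star]⟩

theorem mem_closure_range_iff (hι : IsIdealEmbedding ι) {α : Type*} {f : α → T} {t : T} :
    ι t ∈ closure (Set.range fun y => ι (f y)) ↔ t ∈ closure (Set.range f) := by
  rw [← Function.comp_def, Set.range_comp,
    hι.isometry.isClosedEmbedding.isInducing.closure_eq_preimage_closure_image (Set.range f)]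
  rfl

variable [PartialOrder M] [StarOrderedRing M]

theorem mem_closure_of_star_mul_self_le (hι : IsIdealEmbedding ι) {b c : T}
    (h : star (ι b) * ι b ≤ star (ι c) * ι c) : b ∈ closure (Set.range fun r : T => r * c) := by
  obtain ⟨d, hd⟩ : ∃ d : M, d = star (ι c) * ι c := ⟨_, rfl⟩
  have hdsa : IsSelfAdjoint d := hd ▸ IsSelfAdjoint.star_mul_self _
  have hspec : ∀ t ∈ spectrum ℝ d, 0 ≤ t := by
    subst hd; exact spectrum_star_mul_self_nonneg
  rw [Metric.mem_closure_iff]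
  intro ε hε
  obtain ⟨δ, hδ⟩ : ∃ δ : ℝ, δ = ε ^ 2 := ⟨_, rfl⟩
  have hδ0 : 0 < δ := by rw [hδ]; positivity
  obtain ⟨g, hg⟩ : ∃ g : ℝ → ℝ, ∀ t, g t = (max t 0 + δ)⁻¹ := ⟨_, fun _ => rfl⟩
  have hpos : ∀ t : ℝ, 0 < max t 0 + δ := fun t => by positivity
  have hgc : Continuous g := by
    rw [funext hg]
    exact Continuous.inv₀ (by fun_prop) fun t => (hpos t).ne'
  have hgc' := hgc.continuousOn (s := spectrum ℝ d)
  obtain ⟨k, hk⟩ : ∃ k : ℝ → ℝ, ∀ t, k t = 1 - g t * t := ⟨_, fun _ => rfl⟩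
  have hkc : ContinuousOn k (spectrum ℝ d) := by
    rw [funext hk]
    exact continuousOn_const.sub (hgc'.mul continuousOn_id)
  have hkd : cfc k d = 1 - cfc g d * d := by
    rw [funext hk, cfc_sub (fun _ => 1) (fun t => g t * t) d continuousOn_const
      (hgc'.mul continuousOn_id), cfc_const_one ℝ d,
      cfc_mul g (fun t => t) d hgc' continuousOn_id, cfc_id' ℝ d hdsa]
  have hksa : star (cfc k d) = cfc k d := cfc_predicate (R := ℝ) (p := IsSelfAdjoint) k d
  obtain ⟨r, hr⟩ := hι.exists_mul_right (cfc g d) b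
  refine ⟨r * star c * c, ⟨r * star c, rfl⟩, ?_⟩
  have hdiff : ι (b - r * star c * c) = ι b * cfc k d := by
    rw [map_sub, map_mul, map_mul, hr, map_star, hkd, mul_sub, mul_one, hd]
    simp only [mul_assoc]
  have hle : ‖ι b * cfc k d‖ ^ 2 ≤ δ / 2 := by
    have h1 : star (ι b * cfc k d) * (ι b * cfc k d) ≤ star (cfc k d) * d * cfc k d := by
      have := star_left_conjugate_le_conjugate (hd ▸ h) (cfc k d)
      simpa only [star_mul, mul_assoc] using this
    have h2 : star (cfc k d) * d * cfc k d = cfc (fun t => k t * t * k t) d := by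
      rw [cfc_mul (fun t => k t * t) k d (hkc.mul continuousOn_id) hkc,
        cfc_mul k (fun t => t) d hkc continuousOn_id, cfc_id' ℝ d hdsa, hksa]
    rw [sq, ← CStarRing.norm_star_mul_self]
    refine (CStarAlgebra.norm_le_norm_of_nonneg_of_le (star_mul_self_nonneg _) h1).trans ?_
    rw [h2]
    refine norm_cfc_le (by positivity) fun t ht => ?_
    have ht0 := hspec t ht
    have hkt : k t = δ / (t + δ) := by
      rw [hk, hg, max_eq_left ht0]; field_simp; ring
    have : 0 ≤ k t * t * k t := by rw [hkt]; positivity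
    rw [Real.norm_eq_abs, abs_of_nonneg this, hkt,
      show δ / (t + δ) * t * (δ / (t + δ)) = (δ * δ * t) / ((t + δ) * (t + δ)) by field_simp,
      div_le_iff₀ (by positivity)]
    nlinarith [mul_pos hδ0 hδ0, mul_nonneg ht0 hδ0.le, mul_nonneg hδ0.le (sq_nonneg (t - δ)),
      mul_nonneg hδ0.le (sq_nonneg t), mul_nonneg hδ0.le (sq_nonneg (δ))]
  rw [dist_eq_norm, ← hι.isometry.norm_map_of_map_zero (map_zero ι), hdiff]
  refine lt_of_pow_lt_pow_left₀ 2 hε.le (hle.trans_lt ?_)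
  rw [← hδ]; linarith

theorem cuntzBelow_of_star_mul_self_le (hι : IsIdealEmbedding ι) {b c : T}
    (h : star (ι b) * ι b ≤ star (ι c) * ι c) : CuntzBelow (b * star b) (c * star c) :=
  .of_mem_closure (hι.mem_closure_of_star_mul_self_le h)

theorem cuntzBelow_of_le (hι : IsIdealEmbedding ι) {a b : T} (ha : CStarNonneg a)
    (hb : CStarNonneg b) (hab : ι a ≤ ι b) : CuntzBelow a b := by
  obtain ⟨h, hh, rfl⟩ := ha.exists_sqrt
  obtain ⟨k, hk, rfl⟩ := hb.exists_sqrt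
  have := hι.cuntzBelow_of_star_mul_self_le (b := h) (c := k)
    (by rwa [← map_star, ← map_star, hh.star_eq, hk.star_eq, ← map_mul, ← map_mul])
  rwa [hh.star_eq, hk.star_eq] at this

theorem cuntzBelow_mul_star_self (hι : IsIdealEmbedding ι) (c : T) :
    CuntzBelow (c * star c) (star c * c) := by
  obtain ⟨h, hh, heq⟩ := (CStarNonneg.mul_star_self c).exists_sqrt
  have := hι.cuntzBelow_of_star_mul_self_le (b := h) (c := star c)
    (by rw [← map_star, ← map_star, hh.star_eq, star_star, ← map_mul, ← map_mul, heq])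
  rwa [hh.star_eq, star_star, heq] at this

end IsIdealEmbedding

namespace IsCuntzSemigroupOf

variable {A : Type*} [NonUnitalCStarAlgebra A] {S : Type*} [CuSemigroup S]
  (hS : IsCuntzSemigroupOf A S)

theorem _root_.CuSemigroup.add_le_add_of_le {a b c d : S} (h₁ : a ≤ b) (h₂ : c ≤ d) :
    a + c ≤ b + d := by
  calc a + c ≤ a + d := CuSemigroup.add_le_add' _ _ h₂ a
    _ = d + a := add_comm _ _
    _ ≤ d + b := CuSemigroup.add_le_add' _ _ h₁ d
    _ = b + d := add_comm _ _

theorem _root_.CuSemigroup.sum_le_sum {κ : Type*} (s : Finset κ) {f g : κ → S}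
    (h : ∀ i, f i ≤ g i) : ∑ i ∈ s, f i ≤ ∑ i ∈ s, g i := by
  classical
  induction s using Finset.induction_on with
  | empty => simp
  | insert i s his ih =>
    rw [Finset.sum_insert his, Finset.sum_insert his]
    exact CuSemigroup.add_le_add_of_le (h i) ih

theorem cls_sum_orth {κ : Type*} (s : Finset κ) {a : κ → hS.stab}
    (ha : ∀ i, CStarNonneg (a i)) (horth : ∀ i j, i ≠ j → a i * a j = 0) :
    hS.cls (∑ i ∈ s, a i) = ∑ i ∈ s, hS.cls (a i) := by
  classical
  induction s using Finset.induction_on with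
  | empty => simpa using hS.cls_zero
  | insert i s his ih =>
    rw [Finset.sum_insert his, Finset.sum_insert his, ← ih]
    refine hS.cls_add_orth _ _ (ha i) (.sum s ha) ?_
    rw [Finset.mul_sum]
    exact Finset.sum_eq_zero fun j hj => horth i j fun h => his (h ▸ hj)

variable {M : Type*} [CStarAlgebra M] {ι : hS.stab →⋆ₙₐ[ℂ] M}

theorem cls_star_mul_self (hι : IsIdealEmbedding ι) (c : hS.stab) :
    hS.cls (c * star c) = hS.cls (star c * c) := by
  let _ := CStarAlgebra.spectralOrder M
  let _ := CStarAlgebra.spectralOrderedRing M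
  refine le_antisymm ((hS.cls_le_iff _ _ (.mul_star_self c) (.star_mul_self c)).2
    (hι.cuntzBelow_mul_star_self c))
    ((hS.cls_le_iff _ _ (.star_mul_self c) (.mul_star_self c)).2 ?_)
  simpa using hι.cuntzBelow_mul_star_self (star c)

theorem cls_add_le (hι : IsIdealEmbedding ι) {a b : hS.stab} (ha : CStarNonneg a)
    (hb : CStarNonneg b) : hS.cls (a + b) ≤ hS.cls a + hS.cls b := by
  let _ := CStarAlgebra.spectralOrder M
  let _ := CStarAlgebra.spectralOrderedRing M
  obtain ⟨a', b', ha', hb', horth, hca, hcb⟩ := hS.exists_orth a b ha hb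
  rw [← hca, ← hcb, ← hS.cls_add_orth a' b' ha' hb' horth,
    hS.cls_le_iff _ _ (ha.add hb) (ha'.add hb')]
  obtain ⟨r, hr⟩ := (hS.cls_le_iff a a' ha ha').1 hca.ge
  obtain ⟨s, hs⟩ := (hS.cls_le_iff b b' hb hb').1 hcb.ge
  obtain ⟨g, hg, rfl⟩ := ha'.exists_sqrt
  obtain ⟨d, hd, rfl⟩ := hb'.exists_sqrt
  have hgd : g * d = 0 := by
    have h1 : star (g * (d * d)) * (g * (d * d)) = 0 := by
      rw [star_mul, hg.star_eq, mul_assoc, ← mul_assoc g g, horth, mul_zero]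
    have h2 := CStarRing.star_mul_self_eq_zero_iff _ |>.1 h1
    have h3 : (g * d) * star (g * d) = 0 := by
      rw [star_mul, hg.star_eq, hd.star_eq, mul_assoc, ← mul_assoc d d, ← mul_assoc, h2, zero_mul]
    exact CStarRing.mul_star_self_eq_zero_iff _ |>.1 h3
  have hdg : d * g = 0 := by
    have := congrArg star hgd
    rwa [star_mul, hg.star_eq, hd.star_eq, star_zero] at this
  have hsum : (g + d) * star (g + d) = g * g + d * d := by
    rw [star_add, hg.star_eq, hd.star_eq, mul_add, add_mul, add_mul, hgd, hdg]; simp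
  have hsum' : star (g + d) * (g + d) = g * g + d * d := by
    rw [star_add, hg.star_eq, hd.star_eq, mul_add, add_mul, add_mul, hgd, hdg]; simp
  have hnonneg : ∀ c : hS.stab, IsSelfAdjoint c → 0 ≤ ι (c * c) := fun c hc => by
    nth_rewrite 1 [← hc.star_eq]
    rw [map_mul, map_star]; exact star_mul_self_nonneg _
  have hgc : g ∈ closure (Set.range fun r : hS.stab => r * (g + d)) :=
    hι.mem_closure_of_star_mul_self_le (by
      rw [← map_star, ← map_star, ← map_mul, ← map_mul, hsum', hg.star_eq, map_add]
      exact le_add_of_nonneg_right (hnonneg d hd))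
  have hdc : d ∈ closure (Set.range fun r : hS.stab => r * (g + d)) :=
    hι.mem_closure_of_star_mul_self_le (by
      rw [← map_star, ← map_star, ← map_mul, ← map_mul, hsum', hd.star_eq, map_add]
      exact le_add_of_nonneg_left (hnonneg g hg))
  have hcl : ∀ u v : hS.stab,
      u * g + v * d ∈ closure (Set.range fun r : hS.stab => r * (g + d)) := by
    intro u v
    have hc : Continuous fun z : hS.stab × hS.stab => u * z.1 + v * z.2 := by fun_prop
    refine map_mem_closure₂ (f := fun x y => u * x + v * y) hc hgc hdc ?_
    rintro _ ⟨x, rfl⟩ _ ⟨y, rfl⟩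
    exact ⟨u * x + v * y, by simp only [add_mul, mul_assoc]⟩
  rw [cuntzBelow_iff_mem_closure]
  refine isClosed_closure.mem_of_tendsto (hr.add hs) (Eventually.of_forall fun n => ?_)
  have := CuntzBelow.of_mem_closure (hcl (r n) (s n))
  rw [hsum, cuntzBelow_iff_mem_closure] at this
  convert this using 1
  rw [star_add, star_mul, star_mul, hg.star_eq, hd.star_eq, add_mul, mul_add, mul_add]
  have e1 : r n * g * (d * star (s n)) = 0 := by
    rw [mul_assoc, ← mul_assoc g, hgd]; simp
  have e2 : s n * d * (g * star (r n)) = 0 := by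
    rw [mul_assoc, ← mul_assoc d, hdg]; simp
  rw [e1, e2]
  simp only [mul_assoc, add_zero, zero_add]

theorem cls_sum_le (hι : IsIdealEmbedding ι) {κ : Type*} (s : Finset κ) {a : κ → hS.stab}
    (ha : ∀ i, CStarNonneg (a i)) : hS.cls (∑ i ∈ s, a i) ≤ ∑ i ∈ s, hS.cls (a i) := by
  classical
  induction s using Finset.induction_on with
  | empty => simpa using hS.cls_zero.le
  | insert i s his ih =>
    rw [Finset.sum_insert his, Finset.sum_insert his]
    exact (hS.cls_add_le hι (ha i) (.sum s ha)).trans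
      (CuSemigroup.add_le_add' _ _ ih _)

end IsCuntzSemigroupOf

end CuntzComparison

section Divisibility

namespace IsCuntzSemigroupOf

variable {A : Type*} [NonUnitalCStarAlgebra A] {S : Type*} [CuSemigroup S]
  (hS : IsCuntzSemigroupOf A S)

theorem nsmul_cls_le_of_isOrthogonalSystem {M : Type*} [CStarAlgebra M]
    {ι : hS.stab →⋆ₙₐ[ℂ] M} (hι : IsIdealEmbedding ι) {p : M} {x : hS.stab}
    (hcl : ∀ w, p * ι w ∈ closure (Set.range fun y => ι (x * y)))
    {m : ℕ} {v : Fin m → M} {e : M} (hv : IsOrthogonalSystem p v e) {d : hS.stab}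
    (hd : ι d = star (ι x) * e * ι x) : m • hS.cls d ≤ hS.cls (star x * x) := by
  choose g hg using fun i => hι.exists_mul_left (v i) x
  have hgg : ∀ i j, star (g i) * g j = if i = j then d else 0 := by
    intro i j
    apply hι.injective
    have : ι (star (g i) * g j) = star (ι x) * (star (v i) * v j) * ι x := by
      rw [map_mul, map_star, hg, hg, star_mul]; simp only [mul_assoc]
    rw [this, hv.star_mul_apply]
    split_ifs <;> simp [hd]
  have hpos : ∀ i, CStarNonneg (g i * star (g i)) := fun i => .mul_star_self _
  have hcls : ∀ i, hS.cls (g i * star (g i)) = hS.cls d := fun i => by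
    rw [hS.cls_star_mul_self hι, hgg, if_pos rfl]
  have hsum : m • hS.cls d = hS.cls (∑ i, g i * star (g i)) := by
    rw [hS.cls_sum_orth _ hpos]
    · simp [hcls]
    · intro i j hij
      rw [mul_assoc, ← mul_assoc (star _), hgg, if_neg hij]; simp
  have hD : CStarNonneg (∑ i, g i * star (g i)) := .sum _ hpos
  rw [hsum, hS.cls_le_iff _ _ hD (.star_mul_self x)]
  obtain ⟨h, hh, heq⟩ := hD.exists_sqrt
  have hph : p * ι h = ι h := by
    refine mul_eq_self_of_mul_mul_self (hh.map ι) ?_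
    rw [← map_mul, heq, map_sum, Finset.mul_sum]
    refine Finset.sum_congr rfl fun i _ => ?_
    rw [map_mul, hg, ← mul_assoc, ← mul_assoc, hv.mul_left]
  have hmem : star h ∈ closure (Set.range fun r => x * r) := by
    rw [hh.star_eq, ← hι.mem_closure_range_iff, ← hph]
    exact hcl h
  have := CuntzBelow.of_star_mem_closure hmem
  rwa [hh.star_eq, heq] at this

theorem cls_conjugate_le {M : Type*} [CStarAlgebra M]
    {ι : hS.stab →⋆ₙₐ[ℂ] M} (hι : IsIdealEmbedding ι) {p : M} {x : hS.stab}
    (hcl : ∀ w, p * ι w ∈ closure (Set.range fun y => ι (x * y)))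
    {s v : M} (hv : v * p = v) {h d : hS.stab} (hh : ι h = star (ι x) * s * star v)
    (hd : ι d = star (ι x) * (star v * v) * ι x) : hS.cls (h * star h) ≤ hS.cls d := by
  obtain ⟨c, hc⟩ := hι.exists_mul_left v x
  have hdc : star c * c = d := by
    apply hι.injective
    rw [map_mul, map_star, hc, hd, star_mul]; simp only [mul_assoc]
  obtain ⟨w, hw⟩ := hι.exists_mul_left (star s) x
  rw [← hdc, hS.cls_le_iff _ _ (.mul_star_self h) (.star_mul_self c)]
  refine .of_star_mem_closure ?_
  rw [← hι.mem_closure_range_iff]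
  have hstar : ι (star h) = v * (p * ι w) := by
    rw [map_star, hh, star_mul, star_mul, star_star, star_star, hw, ← mul_assoc, ← mul_assoc,
      hv, mul_assoc]
  rw [hstar]
  refine map_mem_closure (f := fun z => v * z) (by fun_prop) (hcl w) ?_
  rintro _ ⟨y, rfl⟩
  exact ⟨y, by simp only [map_mul, hc, mul_assoc]⟩

/-- If the unital C⋆-algebra `M` contains `A ⊗ K` as an ideal and is nowhere scattered, and `p` is
a projection of `M` which is the support of `x ∈ A ⊗ K`, then `[x⋆x]` is bounded by a finite sum
of elements `y` with `m y ≤ [x⋆x]`. -/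
theorem exists_nsmul_le_of_nowhereScattered {M : Type} [CStarAlgebra M]
    (hns : NowhereScattered M) {ι : hS.stab →⋆ₙₐ[ℂ] M} (hι : IsIdealEmbedding ι) {p : M}
    (hp : IsProjectionElem p) {x : hS.stab} (hpx : p * ι x = ι x)
    (hcl : ∀ w, p * ι w ∈ closure (Set.range fun y => ι (x * y))) {m : ℕ} (hm : 0 < m) :
    ∃ (n : ℕ) (y : Fin n → S), (∀ j, m • y j ≤ hS.cls (star x * x)) ∧
      hS.cls (star x * x) ≤ ∑ j, y j := by
  let _ := CStarAlgebra.spectralOrder M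
  let _ := CStarAlgebra.spectralOrderedRing M
  obtain ⟨κ, _, e, s, v, hv, hle⟩ := exists_le_sum_of_nowhereScattered hns hp hm
  obtain ⟨i₀⟩ : Nonempty (Fin m) := ⟨⟨0, hm⟩⟩
  have hd' : ∀ j, ∃ d, ι d = star (ι x) * e j * ι x := fun j => by
    obtain ⟨t, ht⟩ := hι.exists_mul_left (e j) x
    exact ⟨star x * t, by rw [map_mul, map_star, ht, mul_assoc]⟩
  have hh' : ∀ j, ∃ h, ι h = star (ι x) * s j * star (v j i₀) := fun j => by
    obtain ⟨t, ht⟩ := hι.exists_mul_right (s j * star (v j i₀)) (star x)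
    exact ⟨t, by rw [ht, map_star, mul_assoc]⟩
  choose d hd using hd'
  choose h hh using hh'
  refine ⟨Fintype.card κ, fun j => hS.cls (d ((Fintype.equivFin κ).symm j)), fun j => ?_, ?_⟩
  · exact hS.nsmul_cls_le_of_isOrthogonalSystem hι hcl (hv _) (hd _)
  · rw [Equiv.sum_comp (Fintype.equivFin κ).symm fun j => hS.cls (d j)]
    have hpos : ∀ j, CStarNonneg (h j * star (h j)) := fun j => .mul_star_self _
    calc hS.cls (star x * x) ≤ hS.cls (∑ j, h j * star (h j)) := by
          rw [hS.cls_le_iff _ _ (.star_mul_self x) (.sum _ hpos)]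
          refine hι.cuntzBelow_of_le (.star_mul_self x) (.sum _ hpos) ?_
          have := star_left_conjugate_le_conjugate hle (ι x)
          rw [mul_assoc, hpx, ← map_star, ← map_mul, Finset.mul_sum, Finset.sum_mul] at this
          refine this.trans_eq ?_
          rw [map_sum]
          refine Finset.sum_congr rfl fun j _ => ?_
          rw [map_mul, map_star ι (h j), hh, ← (hv j).star_mul_self i₀, map_star]
          simp only [star_mul, star_star, mul_assoc]
      _ ≤ ∑ j, hS.cls (h j * star (h j)) := hS.cls_sum_le hι _ hpos
      _ ≤ ∑ j, hS.cls (d j) := CuSemigroup.sum_le_sum _ fun j =>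
          hS.cls_conjugate_le hι hcl ((hv j).apply_mul_right i₀) (hh j)
            (by rw [(hv j).star_mul_self, hd])

end IsCuntzSemigroupOf

end Divisibility

section StrictLimits

namespace DoubleCentralizer

variable {A : Type*} [NonUnitalCStarAlgebra A]

theorem mul_coeHom (P : 𝓜(ℂ, A)) (y : A) :
    P * coeHom (𝕜 := ℂ) y = coeHom (𝕜 := ℂ) (P.fst y) := by
  have h : ∀ a b : A, P.fst (a * b) = P.fst a * b := fun a b => by
    have key : ∀ z : A, z * (P.fst (a * b) - P.fst a * b) = 0 := fun z => by
      rw [mul_sub, ← P.central, ← mul_assoc z, ← P.central, mul_assoc, sub_self]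
    exact sub_eq_zero.1 (CStarRing.star_mul_self_eq_zero_iff _ |>.1 (key _))
  refine DoubleCentralizer.ext _ _ _ _ (Prod.ext ?_ ?_)
  · ext z
    exact h y z
  · ext z
    exact P.central z y

theorem isIdealEmbedding_coeHom : IsIdealEmbedding (coeHom (𝕜 := ℂ) (A := A)) where
  injective := by
    rw [injective_iff_map_eq_zero]
    intro a ha
    have : a * star a = 0 := congrArg (fun P : 𝓜(ℂ, A) => P.fst (star a)) ha
    exact CStarRing.mul_star_self_eq_zero_iff _ |>.1 this
  exists_mul_left P t := ⟨P.fst t, (mul_coeHom P t).symm⟩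

/-- A sequence of self-adjoint elements which converges strictly to an idempotent operator
defines a projection in the multiplier algebra. -/
theorem exists_isProjectionElem_of_tendsto {q : ℕ → A} (hq : ∀ n, IsSelfAdjoint (q n))
    {L : A → A} (hL : ∀ y, Tendsto (fun n => q n * y) atTop (𝓝 (L y)))
    (hidem : ∀ y, L (L y) = L y) :
    ∃ P : 𝓜(ℂ, A), IsProjectionElem P ∧
      ∀ y, P * coeHom (𝕜 := ℂ) y = coeHom (𝕜 := ℂ) (L y) := by
  have hR : ∀ y, Tendsto (fun n => y * q n) atTop (𝓝 (star (L (star y)))) := fun y => by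
    have := (hL (star y)).star
    simpa [(hq _).star_eq] using this
  let F : A →L[ℂ] A := continuousLinearMapOfTendsto
    (fun n => ContinuousLinearMap.mul ℂ A (q n)) (f := L) (tendsto_pi_nhds.2 hL)
  let G : A →L[ℂ] A := continuousLinearMapOfTendsto
    (fun n => (ContinuousLinearMap.mul ℂ A).flip (q n)) (f := fun y => star (L (star y)))
    (tendsto_pi_nhds.2 hR)
  have hF : ∀ y, F y = L y := fun _ => rfl
  have hG : ∀ y, G y = star (L (star y)) := fun _ => rfl
  let P : 𝓜(ℂ, A) := ⟨(F, G), fun x y => by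
    refine tendsto_nhds_unique ((hR x).mul_const y) ?_
    exact ((hL y).const_mul x).congr fun n => (mul_assoc _ _ _).symm⟩
  refine ⟨P, ⟨?_, ?_⟩, fun y => mul_coeHom P y⟩
  · refine DoubleCentralizer.ext _ _ _ _ (Prod.ext ?_ ?_)
    · ext y
      change star (G (star y)) = F y
      rw [hF, hG, star_star, star_star]
    · ext y
      change star (F (star y)) = G y
      rw [hF, hG]
  · refine DoubleCentralizer.ext _ _ _ _ (Prod.ext ?_ ?_)
    · ext y
      exact hidem y
    · ext y
      change star (L (star (star (L (star y))))) = star (L (star y))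
      rw [star_star, hidem]

end DoubleCentralizer

end StrictLimits

section SupportProjection

variable {T : Type*} [NonUnitalCStarAlgebra T]

theorem isClosed_setOf_cauchySeq_mul {a : ℕ → T} (ha : ∀ n, ‖a n‖ ≤ 1) :
    IsClosed {r : T | CauchySeq fun n => a n * r} := by
  refine isClosed_of_closure_subset fun r hr => ?_
  rw [Set.mem_ofPred_eq, Metric.cauchySeq_iff']
  intro ε hε
  obtain ⟨t, ht, htr⟩ := Metric.mem_closure_iff.1 hr (ε / 3) (by positivity)
  obtain ⟨N, hN⟩ := Metric.cauchySeq_iff'.1 ht (ε / 3) (by positivity)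
  refine ⟨N, fun n hn => ?_⟩
  have key : ∀ k, dist (a k * r) (a k * t) < ε / 3 := fun k => by
    rw [dist_eq_norm, ← mul_sub]
    refine (norm_mul_le _ _).trans_lt ?_
    rw [← dist_eq_norm]
    nlinarith [ha k, norm_nonneg (a k), dist_nonneg (x := r) (y := t)]
  have := dist_triangle4 (a n * r) (a n * t) (a N * t) (a N * r)
  have h1 := key n
  have h2 := key N
  rw [dist_comm] at h2
  linarith [hN n hn]

theorem isClosed_setOf_tendsto_mul_self {a : ℕ → T} (ha : ∀ n, ‖a n‖ ≤ 1) :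
    IsClosed {r : T | Tendsto (fun n => a n * r) atTop (𝓝 r)} := by
  refine isClosed_of_closure_subset fun r hr => ?_
  rw [Set.mem_ofPred_eq, Metric.tendsto_atTop]
  intro ε hε
  obtain ⟨t, ht, htr⟩ := Metric.mem_closure_iff.1 hr (ε / 3) (by positivity)
  obtain ⟨N, hN⟩ := Metric.tendsto_atTop.1 ht (ε / 3) (by positivity)
  refine ⟨N, fun n hn => ?_⟩
  have key : dist (a n * r) (a n * t) < ε / 3 := by
    rw [dist_eq_norm, ← mul_sub]
    refine (norm_mul_le _ _).trans_lt ?_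
    rw [← dist_eq_norm]
    nlinarith [ha n, norm_nonneg (a n), dist_nonneg (x := r) (y := t)]
  have := dist_triangle4 (a n * r) (a n * t) t r
  rw [dist_comm t r] at this
  linarith [hN n hn]

theorem tendsto_mul_zero_of_norm_le_one {a y : ℕ → T} (ha : ∀ n, ‖a n‖ ≤ 1)
    (hy : Tendsto y atTop (𝓝 0)) : Tendsto (fun n => a n * y n) atTop (𝓝 0) := by
  refine squeeze_zero_norm (fun n => ?_) (tendsto_zero_iff_norm_tendsto_zero.1 hy)
  exact (norm_mul_le _ _).trans (mul_le_of_le_one_left (norm_nonneg _) (ha n))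

/-- A sequence of contractions `Vₙ` that behaves like the truncations of a partial isometry `V`
with initial space the closure of `s T` yields the range projection `V V⋆`, as a strict limit. -/
theorem exists_tendsto_mul_star_of_contractions {V : ℕ → T} {s : T} (hV : ∀ n, ‖V n‖ ≤ 1)
    (hVV : ∀ n k, n ≤ k → star (V k) * V n = star (V n) * V n) (hs : IsSelfAdjoint s)
    (hcs : Tendsto (fun n => star (V n) * V n * s) atTop (𝓝 s)) {W : Set T} (hW : Dense W)
    (hVW : ∀ w ∈ W, ∃ d ∈ closure (Set.range fun r => s * r),
      Tendsto (fun n => star (V n) * w) atTop (𝓝 d)) :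
    ∃ (L : T → T) (x : T), (∀ w, Tendsto (fun n => V n * star (V n) * w) atTop (𝓝 (L w))) ∧
      (∀ w, L (L w) = L w) ∧ star x * x = s * s ∧ L x = x ∧
      ∀ w, L w ∈ closure (Set.range fun y => x * y) := by
  have hV' : ∀ n, ‖star (V n)‖ ≤ 1 := fun n => (norm_star (V n)).trans_le (hV n)
  have hc : ∀ n, ‖star (V n) * V n‖ ≤ 1 := fun n => by
    rw [CStarRing.norm_star_mul_self]; exact mul_le_one₀ (hV n) (norm_nonneg _) (hV n)
  have hVV' : ∀ n k, n ≤ k → star (V n) * V k = star (V n) * V n := fun n k hnk => by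
    have := congrArg star (hVV n k hnk)
    simpa using this
  have hxs : CauchySeq fun n => V n * s := by
    have hz : Tendsto (fun n => s * (star (V n) * V n * s)) atTop (𝓝 (s * s)) := hcs.const_mul s
    rw [Metric.cauchySeq_iff']
    intro ε hε
    obtain ⟨N, hN⟩ := Metric.cauchySeq_iff'.1 hz.cauchySeq (ε ^ 2) (by positivity)
    refine ⟨N, fun n hn => ?_⟩
    have h1 : star (V n * s - V N * s) * (V n * s - V N * s) =
        s * (star (V n) * V n * s) - s * (star (V N) * V N * s) := by
      have e1 : star (V n * s) * (V N * s) = s * (star (V N) * V N * s) := by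
        rw [star_mul, hs.star_eq, mul_assoc, ← mul_assoc _ _ s, hVV N n hn]
      have e2 : star (V N * s) * (V n * s) = s * (star (V N) * V N * s) := by
        rw [star_mul, hs.star_eq, mul_assoc, ← mul_assoc _ _ s, hVV' N n hn]
      have e3 : ∀ k, star (V k * s) * (V k * s) = s * (star (V k) * V k * s) := fun k => by
        rw [star_mul, hs.star_eq, mul_assoc, ← mul_assoc _ _ s]
      rw [star_sub, sub_mul, mul_sub, mul_sub, e1, e2, e3, e3]
      abel
    rw [dist_eq_norm]
    refine lt_of_pow_lt_pow_left₀ 2 hε.le ?_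
    rw [sq, ← CStarRing.norm_star_mul_self, h1, ← dist_eq_norm]
    exact hN n hn
  obtain ⟨x, hx⟩ := cauchySeq_tendsto_of_complete hxs
  have hE : ∀ r ∈ closure (Set.range fun r => s * r), CauchySeq fun n => V n * r := by
    refine fun r hr => closure_minimal ?_ (isClosed_setOf_cauchySeq_mul hV) hr
    rintro _ ⟨t, rfl⟩
    have h := (hx.mul_const t).cauchySeq
    simp only [mul_assoc] at h
    exact h
  have hcE : ∀ r ∈ closure (Set.range fun r => s * r),
      Tendsto (fun n => star (V n) * V n * r) atTop (𝓝 r) := by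
    refine fun r hr => closure_minimal ?_ (isClosed_setOf_tendsto_mul_self hc) hr
    rintro _ ⟨t, rfl⟩
    exact (hcs.mul_const t).congr fun n => mul_assoc _ _ _
  have hD : ∀ w, ∃ d ∈ closure (Set.range fun r => s * r),
      Tendsto (fun n => star (V n) * w) atTop (𝓝 d) := by
    intro w
    have hcauchy : CauchySeq fun n => star (V n) * w := by
      refine closure_minimal (fun z hz => ?_) (isClosed_setOf_cauchySeq_mul hV') (hW w)
      obtain ⟨d, -, hd⟩ := hVW z hz
      exact hd.cauchySeq
    obtain ⟨d, hd⟩ := cauchySeq_tendsto_of_complete hcauchy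
    refine ⟨d, ?_, hd⟩
    rw [← closure_closure, Metric.mem_closure_iff]
    intro ε hε
    obtain ⟨z, hz, hzw⟩ := Metric.mem_closure_iff.1 (hW w) (ε / 2) (by positivity)
    obtain ⟨d', hd'E, hd'⟩ := hVW z hz
    refine ⟨d', hd'E, lt_of_le_of_lt ?_ (half_lt_self hε)⟩
    refine le_of_tendsto (hd.dist hd') (Eventually.of_forall fun n => ?_)
    rw [dist_eq_norm, ← mul_sub]
    refine (norm_mul_le _ _).trans ((mul_le_of_le_one_left (norm_nonneg _) (hV' n)).trans ?_)
    rw [← dist_eq_norm]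
    exact hzw.le
  choose D hDE hDw using hD
  have hL : ∀ w, ∃ l, Tendsto (fun n => V n * D w) atTop (𝓝 l) := fun w =>
    cauchySeq_tendsto_of_complete (hE _ (hDE w))
  choose L hLw using hL
  have hlim : ∀ w, Tendsto (fun n => V n * star (V n) * w) atTop (𝓝 (L w)) := fun w => by
    have h0 : Tendsto (fun n => star (V n) * w - D w) atTop (𝓝 0) := by
      simpa using (hDw w).sub_const (D w)
    have := (tendsto_mul_zero_of_norm_le_one hV h0).add (hLw w)
    simpa [mul_sub, mul_assoc] using this
  have hfix : ∀ (r z : T), Tendsto (fun n => star (V n) * V n * r) atTop (𝓝 r) →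
      Tendsto (fun n => V n * r) atTop (𝓝 z) → L z = z := by
    intro r z hr hz
    refine tendsto_nhds_unique (hlim z) ?_
    have h1 : ∀ n, star (V n) * z = star (V n) * V n * r := fun n => by
      refine tendsto_nhds_unique (hz.const_mul _) (tendsto_const_nhds.congr' ?_)
      filter_upwards [eventually_ge_atTop n] with k hk
      rw [← mul_assoc, hVV' n k hk]
    have h0 : Tendsto (fun n => star (V n) * V n * r - r) atTop (𝓝 0) := by
      simpa using hr.sub_const r
    have := (tendsto_mul_zero_of_norm_le_one hV h0).add hz
    rw [zero_add] at this
    refine this.congr fun n => ?_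
    rw [mul_assoc _ _ z, h1, mul_sub, sub_add_cancel]
  refine ⟨L, x, hlim, fun w => hfix _ _ (hcE _ (hDE w)) (hLw w), ?_, hfix _ _ hcs hx, fun w => ?_⟩
  · refine tendsto_nhds_unique (hx.star.mul hx) ?_
    refine (hcs.const_mul s).congr fun n => ?_
    rw [star_mul, hs.star_eq]; simp only [mul_assoc]
  · rw [Metric.mem_closure_iff]
    intro ε hε
    obtain ⟨_, ⟨t, rfl⟩, ht⟩ := Metric.mem_closure_iff.1 (hDE w) (ε / 2) (by positivity)
    refine ⟨x * t, ⟨t, rfl⟩, lt_of_le_of_lt ?_ (half_lt_self hε)⟩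
    refine le_of_tendsto ((hLw w).dist (hx.mul_const t)) (Eventually.of_forall fun n => ?_)
    rw [dist_eq_norm, mul_assoc, ← mul_sub]
    refine (norm_mul_le _ _).trans ((mul_le_of_le_one_left (norm_nonneg _) (hV n)).trans ?_)
    rw [← dist_eq_norm]
    exact ht.le

end SupportProjection

section PartitionOfUnity

/-- Functional calculus for a partition of unity of `(0, ∞)`: the elements `gᵢ` have squares which
telescope to an approximate unit `Gₙ` of the hereditary subalgebra generated by `a`. -/
theorem CStarNonneg.exists_telescoping {A : Type*} [NonUnitalCStarAlgebra A] {a : A}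
    (ha : CStarNonneg a) : ∃ (s : A) (G g k : ℕ → A), IsSelfAdjoint s ∧ s * s = a ∧
      (∀ i, IsSelfAdjoint (g i)) ∧ G 0 = 0 ∧ (∀ i, g i * g i = G (i + 1) - G i) ∧
      (∀ n, ‖G n‖ ≤ 1) ∧ Tendsto (fun n => G n * s) atTop (𝓝 s) ∧ ∀ i, g i = s * k i := by
  let _ := CStarAlgebra.spectralOrder A
  let _ := CStarAlgebra.spectralOrderedRing A
  have h0 : 0 ≤ a := CStarAlgebra.nonneg_iff_eq_star_mul_self.2 ha
  have hsa : IsSelfAdjoint a := h0.isSelfAdjoint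
  have hspec : ∀ t ∈ quasispectrum ℝ a, 0 ≤ t := quasispectrum_nonneg_of_nonneg a h0
  obtain ⟨F, hF⟩ : ∃ F : ℕ → ℝ → ℝ, ∀ n t, F n t = min 1 (max 0 (n * t - 1)) :=
    ⟨_, fun _ _ => rfl⟩
  have hFc : ∀ n, Continuous (F n) := fun n => by rw [funext (hF n)]; fun_prop
  have hF0 : ∀ n, F n 0 = 0 := fun n => by simp [hF]
  have hFnn : ∀ n t, 0 ≤ F n t := fun n t => by
    rw [hF]; exact le_min zero_le_one (le_max_left _ _)
  have hF1 : ∀ n t, F n t ≤ 1 := fun n t => by rw [hF]; exact min_le_left _ _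
  have hFmono : ∀ i t, 0 ≤ t → F i t ≤ F (i + 1) t := fun i t ht => by
    rw [hF, hF]; gcongr; simp
  obtain ⟨f, hf⟩ : ∃ f : ℕ → ℝ → ℝ, ∀ i t, f i t = √(F (i + 1) t - F i t) := ⟨_, fun _ _ => rfl⟩
  have hfc : ∀ i, Continuous (f i) := fun i => by
    rw [funext (hf i)]; exact ((hFc _).sub (hFc _)).sqrt
  have hf0 : ∀ i, f i 0 = 0 := fun i => by simp [hf, hF0]
  obtain ⟨k, hk⟩ : ∃ k : ℕ → ℝ → ℝ, ∀ i t, k i t = f i t * (√(max t (1 / (i + 1))))⁻¹ :=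
    ⟨_, fun _ _ => rfl⟩
  have hpos : ∀ (i : ℕ) (t : ℝ), 0 < √(max t (1 / (i + 1))) := fun i t =>
    Real.sqrt_pos.2 (lt_of_lt_of_le (by positivity) (le_max_right _ _))
  have hkc : ∀ i, Continuous (k i) := fun i => by
    rw [funext (hk i)]
    exact (hfc i).mul (Continuous.inv₀ (by fun_prop) fun t => (hpos i t).ne')
  have hk0 : ∀ i, k i 0 = 0 := fun i => by rw [hk, hf0, zero_mul]
  have hsc : ContinuousOn Real.sqrt (quasispectrum ℝ a) := Real.continuous_sqrt.continuousOn
  refine ⟨cfcₙ Real.sqrt a, fun n => cfcₙ (F n) a, fun i => cfcₙ (f i) a, fun i => cfcₙ (k i) a,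
    cfcₙ_predicate (R := ℝ) _ a, ?_, fun i => cfcₙ_predicate (R := ℝ) _ a, ?_, fun i => ?_,
    fun n => ?_, ?_, fun i => ?_⟩
  · rw [← cfcₙ_mul Real.sqrt Real.sqrt a hsc Real.sqrt_zero hsc Real.sqrt_zero]
    conv_rhs => rw [← cfcₙ_id' ℝ a hsa]
    exact cfcₙ_congr fun t ht => Real.mul_self_sqrt (hspec t ht)
  · rw [← cfcₙ_const_zero ℝ a]
    exact cfcₙ_congr fun t _ => by simp [hF]
  · rw [← cfcₙ_mul (f i) (f i) a (hfc i).continuousOn (hf0 i) (hfc i).continuousOn (hf0 i),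
      ← cfcₙ_sub (F (i + 1)) (F i) a (hFc _).continuousOn (hF0 _) (hFc _).continuousOn (hF0 _)]
    refine cfcₙ_congr fun t ht => ?_
    simp only [hf]
    exact Real.mul_self_sqrt (sub_nonneg.2 (hFmono i t (hspec t ht)))
  · refine norm_cfcₙ_le fun t _ => ?_
    rw [Real.norm_eq_abs, abs_of_nonneg (hFnn n t)]
    exact hF1 n t
  · rw [tendsto_iff_norm_sub_tendsto_zero]
    have hlim : Tendsto (fun n : ℕ => √(2 / (n : ℝ))) atTop (𝓝 0) := by
      have := (tendsto_const_div_atTop_nhds_zero_nat (2 : ℝ)).sqrt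
      rwa [Real.sqrt_zero] at this
    refine squeeze_zero' (Eventually.of_forall fun n => norm_nonneg _) ?_ hlim
    filter_upwards [eventually_gt_atTop 0] with n hn
    have hn' : (0 : ℝ) < n := by exact_mod_cast hn
    rw [← cfcₙ_mul (F n) Real.sqrt a (hFc n).continuousOn (hF0 n) hsc Real.sqrt_zero,
      ← cfcₙ_sub (fun t => F n t * √t) Real.sqrt a ((hFc n).continuousOn.mul hsc) (by simp) hsc
        Real.sqrt_zero]
    refine norm_cfcₙ_le fun t ht => ?_
    rcases le_total (2 / (n : ℝ)) t with h | h
    · have : F n t = 1 := by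
        rw [div_le_iff₀ hn'] at h
        rw [hF, min_eq_left]
        exact le_max_of_le_right (by linarith)
      rw [this, one_mul, sub_self, norm_zero]
      exact Real.sqrt_nonneg _
    · have h1 := Real.sqrt_le_sqrt h
      have h2 := Real.sqrt_nonneg t
      rw [Real.norm_eq_abs, abs_le]
      constructor <;> nlinarith [hFnn n t, hF1 n t]
  · rw [← cfcₙ_mul Real.sqrt (k i) a hsc Real.sqrt_zero (hkc i).continuousOn (hk0 i)]
    refine cfcₙ_congr fun t ht => ?_
    have ht0 := hspec t ht
    have hi : (0 : ℝ) < i + 1 := by positivity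
    simp only [hk]
    rcases le_total t (1 / (i + 1)) with h | h
    · rw [le_div_iff₀ hi] at h
      have e1 : F (i + 1) t = 0 := by
        rw [hF, max_eq_left, min_eq_right zero_le_one]
        push_cast; linarith
      have e2 : F i t = 0 := le_antisymm (e1 ▸ hFmono i t ht0) (hFnn i t)
      simp [hf, e1, e2]
    · have := hpos i t
      rw [max_eq_left h] at this ⊢
      field_simp

end PartitionOfUnity

section MatrixUnits

theorem matPad_single {A : Type*} [Zero A] {n i j : ℕ} (hi : i < n) (hj : j < n) (b : A) :
    matPad (Matrix.single (⟨i, hi⟩ : Fin n) (⟨j, hj⟩ : Fin n) b) =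
      Matrix.single (⟨i, hi.trans n.lt_succ_self⟩ : Fin (n + 1))
        (⟨j, hj.trans n.lt_succ_self⟩ : Fin (n + 1)) b := by
  ext k l
  simp only [matPad, Matrix.of_apply, Matrix.single_apply, Fin.ext_iff]
  split_ifs <;> first | rfl | omega

namespace IsCuntzSemigroupOf

variable {A : Type*} [NonUnitalCStarAlgebra A] {S : Type*} [CuSemigroup S]
  (hS : IsCuntzSemigroupOf A S)

/-- The element `b ⊗ eᵢⱼ` of the stabilization. -/
noncomputable def unitEmb (i j : ℕ) (b : A) : hS.stab :=
  hS.matEmb (max i j + 1) (Matrix.single ⟨i, by omega⟩ ⟨j, by omega⟩ b)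

theorem matEmb_single {n i j : ℕ} (hi : i < n) (hj : j < n) (b : A) :
    hS.matEmb n (Matrix.single ⟨i, hi⟩ ⟨j, hj⟩ b) = hS.unitEmb i j b := by
  obtain ⟨k, rfl⟩ : ∃ k, n = max i j + 1 + k := ⟨n - (max i j + 1), by omega⟩
  induction k with
  | zero => rfl
  | succ k ih =>
    rw [← ih (by omega) (by omega), ← hS.matEmb_compat (max i j + 1 + k), matPad_single]
    rfl

theorem matEmb_eq_sum {n : ℕ} (X : Matrix (Fin n) (Fin n) A) :
    hS.matEmb n X = ∑ i : Fin n, ∑ j : Fin n, hS.unitEmb i j (X i j) := by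
  conv_lhs => rw [Matrix.matrix_eq_sum_single X]
  simp only [map_sum]
  exact Finset.sum_congr rfl fun i _ => Finset.sum_congr rfl fun j _ =>
    hS.matEmb_single i.2 j.2 _

theorem unitEmb_mul_same (i j l : ℕ) (b c : A) :
    hS.unitEmb i j b * hS.unitEmb j l c = hS.unitEmb i l (b * c) := by
  obtain ⟨n, hi, hj, hl⟩ : ∃ n, i < n ∧ j < n ∧ l < n := ⟨i + j + l + 1, by omega⟩
  rw [← hS.matEmb_single hi hj, ← hS.matEmb_single hj hl, ← hS.matEmb_single hi hl, ← map_mul,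
    Matrix.single_mul_single_same]

theorem unitEmb_mul_of_ne (i l : ℕ) {j k : ℕ} (hjk : j ≠ k) (b c : A) :
    hS.unitEmb i j b * hS.unitEmb k l c = 0 := by
  obtain ⟨n, hi, hj, hk, hl⟩ : ∃ n, i < n ∧ j < n ∧ k < n ∧ l < n :=
    ⟨i + j + k + l + 1, by omega⟩
  rw [← hS.matEmb_single hi hj, ← hS.matEmb_single hk hl, ← map_mul,
    Matrix.single_mul_single_of_ne _ _ _ _ (by simpa using hjk), map_zero]

theorem star_unitEmb (i j : ℕ) (b : A) : star (hS.unitEmb i j b) = hS.unitEmb j i (star b) := by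
  obtain ⟨n, hi, hj⟩ : ∃ n, i < n ∧ j < n := ⟨i + j + 1, by omega⟩
  rw [← hS.matEmb_single hi hj, ← hS.matEmb_single hj hi, ← map_star,
    Matrix.star_eq_conjTranspose, Matrix.conjTranspose_single]

/-- The corner embedding `a ↦ a ⊗ e₀₀`. -/
noncomputable def cornerEmb : A →⋆ₙₐ[ℂ] hS.stab where
  toFun := hS.unitEmb 0 0
  map_smul' r b := by
    simp only [← hS.matEmb_single zero_lt_one zero_lt_one, ← Matrix.smul_single, map_smul,
      MonoidHom.id_apply]
  map_zero' := by
    simp only [← hS.matEmb_single zero_lt_one zero_lt_one, Matrix.single_zero, map_zero]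
  map_add' b c := by
    simp only [← hS.matEmb_single zero_lt_one zero_lt_one, Matrix.single_add, map_add]
  map_mul' b c := (hS.unitEmb_mul_same 0 0 0 b c).symm
  map_star' b := (hS.star_unitEmb 0 0 b).symm

theorem cls_cornerEmb (a : A) : hS.cls (hS.cornerEmb a) = hS.clsA a := by
  have : hS.cornerEmb a = hS.matEmb 1 (Matrix.of fun _ _ => a) := by
    change hS.unitEmb 0 0 a = _
    rw [← hS.matEmb_single zero_lt_one zero_lt_one]
    congr 1
    ext i j
    simp [Subsingleton.elim i 0, Subsingleton.elim j 0]
  rw [this, clsA]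

open scoped CStarAlgebra in
/-- Every positive element `a` has the form `x⋆x` in the stabilization, where the range projection
of `x` is the strict limit of a sequence of self-adjoint elements. -/
theorem exists_strict_range_projection {a : A} (ha : CStarNonneg a) :
    ∃ (q : ℕ → hS.stab) (L : hS.stab → hS.stab) (x : hS.stab), (∀ n, IsSelfAdjoint (q n)) ∧
      (∀ w, Tendsto (fun n => q n * w) atTop (𝓝 (L w))) ∧ (∀ w, L (L w) = L w) ∧
      star x * x = hS.cornerEmb a ∧ L x = x ∧
      ∀ w, L w ∈ closure (Set.range fun y => x * y) := by
  obtain ⟨s, G, g, k, hs, hss, hg, hG0, hgg, hG1, hGs, hgk⟩ := ha.exists_telescoping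
  obtain ⟨V, hV⟩ : ∃ V : ℕ → hS.stab, ∀ n, V n = ∑ i ∈ Finset.range n, hS.unitEmb i 0 (g i) :=
    ⟨_, fun _ => rfl⟩
  have hstar : ∀ n, star (V n) = ∑ i ∈ Finset.range n, hS.unitEmb 0 i (g i) := fun n => by
    rw [hV, star_sum]
    exact Finset.sum_congr rfl fun i _ => by rw [hS.star_unitEmb, (hg i).star_eq]
  have hVu : ∀ (n i j : ℕ) (b : A), i < n →
      star (V n) * hS.unitEmb i j b = hS.unitEmb 0 j (g i * b) := fun n i j b hi => by
    rw [hstar, Finset.sum_mul, Finset.sum_eq_single i, hS.unitEmb_mul_same]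
    · exact fun l _ hl => hS.unitEmb_mul_of_ne _ _ hl _ _
    · exact fun h => absurd (Finset.mem_range.2 hi) h
  have hVV : ∀ n l, n ≤ l → star (V l) * V n = hS.cornerEmb (G n) := fun n l hnl => by
    have hsum : G n = ∑ i ∈ Finset.range n, g i * g i := by
      simp only [hgg, Finset.sum_range_sub, hG0, sub_zero]
    rw [hV n, Finset.mul_sum, hsum, map_sum]
    exact Finset.sum_congr rfl fun i hi =>
      hVu l i 0 (g i) ((Finset.mem_range.1 hi).trans_le hnl)
  have hnorm : ∀ n, ‖V n‖ ≤ 1 := fun n => by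
    have h1 : ‖V n‖ * ‖V n‖ ≤ 1 := by
      rw [← CStarRing.norm_star_mul_self, hVV n n le_rfl]
      exact (NonUnitalStarAlgHom.norm_apply_le _ _).trans (hG1 n)
    nlinarith [norm_nonneg (V n)]
  have hcs : Tendsto (fun n => star (V n) * V n * hS.cornerEmb s) atTop
      (𝓝 (hS.cornerEmb s)) := by
    have hcont : Continuous hS.cornerEmb := map_continuous hS.cornerEmb
    refine ((hcont.tendsto _).comp hGs).congr fun n => ?_
    rw [Function.comp_apply, map_mul, hVV n n le_rfl]
  have hdense : ∀ w ∈ ⋃ n, Set.range (hS.matEmb n),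
      ∃ d ∈ closure (Set.range fun r => hS.cornerEmb s * r),
        Tendsto (fun n => star (V n) * w) atTop (𝓝 d) := by
    rintro w hw
    obtain ⟨n, X, rfl⟩ := Set.mem_iUnion.1 hw
    refine ⟨_, subset_closure ⟨∑ i : Fin n, ∑ j : Fin n, hS.unitEmb 0 j (k i * X i j), rfl⟩,
      tendsto_const_nhds.congr' ?_⟩
    filter_upwards [eventually_ge_atTop n] with l hl
    rw [hS.matEmb_eq_sum]
    simp only [Finset.mul_sum]
    refine Finset.sum_congr rfl fun i _ => Finset.sum_congr rfl fun j _ => ?_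
    rw [hVu l i j _ (i.2.trans_le hl), hgk, mul_assoc]
    exact hS.unitEmb_mul_same _ _ _ _ _
  obtain ⟨L, x, hL, hidem, hxx, hLx, hcl⟩ := exists_tendsto_mul_star_of_contractions hnorm
    (fun n l hnl => by rw [hVV n l hnl, hVV n n le_rfl]) (hs.map _) hcs hS.matEmb_dense hdense
  exact ⟨_, L, x, fun n => IsSelfAdjoint.mul_star_self (V n), hL, hidem,
    by rw [hxx, ← map_mul, hss], hLx, hcl⟩

end IsCuntzSemigroupOf

end MatrixUnits

theorem WayBelow.le {S : Type*} [PartialOrder S] {x y : S} (h : WayBelow x y) : x ≤ y := by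
  obtain ⟨_, hn⟩ := h (fun _ => y) monotone_const y (by simp) le_rfl
  exact hn

/-- Theorem 5.10.  Let `A` be a σ-unital, stable C*-algebra whose
multiplier algebra is nowhere scattered.  Then for every positive `a ∈ A` and every
`m ∈ ℕ` there are finitely many `y₁, …, yₙ ∈ Cu(A)` with `m·yⱼ ≤ [a]` for all `j` and
`[a] ≤ y₁ + … + yₙ`; in particular `[a]` is weakly `(m, n)`-divisible for some `n`. -/
theorem wdiv_finite_of_stable_multiplier_nowhereScattered
    (A : Type) [NonUnitalCStarAlgebra A] (S : Type) [CuSemigroup S]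
    (hS : IsCuntzSemigroupOf A S)
    (hsigma : SigmaUnital A)
    (hstable : Nonempty (A ≃⋆ₐ[ℂ] hS.stab))
    (hns : NowhereScattered 𝓜(ℂ, A)) :
    ∀ a : A, CStarNonneg a → ∀ m : ℕ,
      ∃ (n : ℕ) (y : Fin n → S), (∀ j, m • y j ≤ hS.clsA a) ∧ (hS.clsA a ≤ ∑ j, y j) ∧
        CuDiv.IsWeaklyDivisible m n (hS.clsA a) := by
  intro a ha m
  suffices h : ∃ (n : ℕ) (y : Fin n → S), (∀ j, m • y j ≤ hS.clsA a) ∧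
      hS.clsA a ≤ ∑ j, y j by
    obtain ⟨n, y, h₁, h₂⟩ := h
    exact ⟨n, y, h₁, h₂, fun x' hx' => ⟨y, hx'.le.trans h₂, h₁⟩⟩
  rcases m.eq_zero_or_pos with rfl | hm
  · exact ⟨1, fun _ => hS.clsA a, fun _ => by simpa using CuSemigroup.zero_le' _, by simp⟩
  obtain ⟨e⟩ := hstable
  obtain ⟨q, L, x, hq, hL, hidem, hxx, hLx, hcl⟩ := hS.exists_strict_range_projection ha
  let f : hS.stab →⋆ₙₐ[ℂ] A := (e.symm : hS.stab →⋆ₙₐ[ℂ] A)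
  have hf : ∀ t, f t = e.symm t := fun _ => rfl
  have hfc : Continuous f := (NonUnitalStarAlgHom.isometry f e.symm.injective).continuous
  obtain ⟨P, hP, hPL⟩ := DoubleCentralizer.exists_isProjectionElem_of_tendsto
    (q := fun n => f (q n)) (L := fun y => f (L (e y))) (fun n => (hq n).map f)
    (fun y => ((hfc.tendsto _).comp (hL (e y))).congr fun n => by
      simp [hf]) (fun y => by simp [hf, hidem])
  let ι : hS.stab →⋆ₙₐ[ℂ] 𝓜(ℂ, A) := (DoubleCentralizer.coeHom (𝕜 := ℂ)).comp f
  have hιf : ∀ t, ι t = DoubleCentralizer.coeHom (𝕜 := ℂ) (f t) := fun _ => rfl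
  have hι : IsIdealEmbedding ι :=
    { injective := DoubleCentralizer.isIdealEmbedding_coeHom.injective.comp e.symm.injective
      exists_mul_left := fun b t => by
        obtain ⟨z, hz⟩ := DoubleCentralizer.isIdealEmbedding_coeHom.exists_mul_left b (f t)
        exact ⟨e z, by rw [hιf, hιf, ← hz, hf, e.symm_apply_apply]⟩ }
  have hPι : ∀ w, P * ι w = ι (L w) := fun w => by
    rw [hιf, hPL, hιf, hf w, e.apply_symm_apply]
  have := hS.exists_nsmul_le_of_nowhereScattered hns hι hP (x := x) (by rw [hPι, hLx])
    (fun w => by rw [hPι, hι.mem_closure_range_iff]; exact hcl w) hm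
  rwa [hxx, hS.cls_cornerEmb] at this
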